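/- arXiv:1304.8097 — 2 statements merged into one kernel-verified Lean document; each statement's English description precedes it below -/
import Mathlib

section
/- The complement ℝ³ \ L of a smooth proper multiray L with countably many components is diffeomorphic to ℝ³. (Remark (3) in Section 8 of the paper.) -/
open Set

/-- `S` is diffeomorphic to `T` (as subsets of ℝ³): there are maps `g, h : ℝ³ → ℝ³`, smooth on
`S` resp. `T`, carrying `S` onto `T` and `T` onto `S`, and inverse to each other on `S` and `T`. -/
def SetDiffeo (S T : Set (EuclideanSpace ℝ (Fin 3))) : Prop :=
  ∃ g h : EuclideanSpace ℝ (Fin 3) → EuclideanSpace ℝ (Fin 3),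
    ContDiffOn ℝ (⊤ : ℕ∞) g S ∧ ContDiffOn ℝ (⊤ : ℕ∞) h T ∧ g '' S = T ∧ h '' T = S ∧
      Set.EqOn (h ∘ g) id S ∧ Set.EqOn (g ∘ h) id T

open Filter Topology in
/-- **Borel's lemma**: every sequence of reals is the sequence of derivatives at `0` of some smooth
function. -/
theorem exists_contDiff_iteratedDeriv_eq (c : ℕ → ℝ) :
    ∃ f : ℝ → ℝ, ContDiff ℝ (⊤ : ℕ∞) f ∧ ∀ k, iteratedDeriv k f 0 = c k := by
  let χ : ContDiffBump (0 : ℝ) := ⟨1, 2, one_pos, one_lt_two⟩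
  let ψ : ℕ → ℝ → ℝ := fun i u => (c i / i.factorial) * (χ u * u ^ i)
  have hψ : ∀ i, ContDiff ℝ (⊤ : ℕ∞) (ψ i) := fun i =>
    contDiff_const.mul (χ.contDiff.mul (contDiff_id.pow i))
  have hψc : ∀ i, HasCompactSupport (ψ i) := fun i =>
    (χ.hasCompactSupport.mul_right).mul_left
  have hbd : ∀ i k, ∃ M, ∀ x, ‖iteratedDeriv k (ψ i) x‖ ≤ M := by
    intro i k
    have h1 := (hψc i).iteratedFDeriv (𝕜 := ℝ) k
    obtain ⟨M, hM⟩ := h1.exists_bound_of_continuous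
      ((hψ i).continuous_iteratedFDeriv (m := k) (mod_cast le_top))
    exact ⟨M, fun x => by rw [← norm_iteratedFDeriv_eq_norm_iteratedDeriv]; exact hM x⟩
  choose M hM using hbd
  have hM0 : ∀ i k, 0 ≤ M i k := fun i k => (norm_nonneg _).trans (hM i k 0)
  let a : ℕ → ℝ := fun i => 1 + 2 ^ i * ∑ k ∈ Finset.range i, M i k
  have hsum : ∀ i, 0 ≤ ∑ k ∈ Finset.range i, M i k := fun i =>
    Finset.sum_nonneg fun k _ => hM0 i k
  have ha1 : ∀ i, 1 ≤ a i := fun i => by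
    have := mul_nonneg (pow_nonneg (zero_le_two (α := ℝ)) i) (hsum i)
    simp only [a]; linarith
  have ha0 : ∀ i, 0 < a i := fun i => one_pos.trans_le (ha1 i)
  have haM : ∀ i k, k < i → (a i)⁻¹ * M i k ≤ (1 / 2) ^ i := by
    intro i k hk
    have h1 : M i k ≤ ∑ k ∈ Finset.range i, M i k :=
      Finset.single_le_sum (f := fun k => M i k) (fun k _ => hM0 i k) (Finset.mem_range.2 hk)
    rw [inv_mul_le_iff₀ (ha0 i), one_div, inv_pow, ← div_eq_mul_inv, le_div_iff₀ (by positivity)]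
    have h2 : M i k * 2 ^ i ≤ (∑ k ∈ Finset.range i, M i k) * 2 ^ i := by gcongr
    simp only [a]; linarith
  let φ : ℕ → ℝ → ℝ := fun i x => ((a i)⁻¹) ^ i * ψ i (a i * x)
  have hφ : ∀ i, ContDiff ℝ (⊤ : ℕ∞) (φ i) := fun i =>
    contDiff_const.mul ((hψ i).comp (contDiff_const.mul contDiff_id))
  have hφd : ∀ i k x, iteratedDeriv k (φ i) x =
      ((a i)⁻¹) ^ i * ((a i) ^ k * iteratedDeriv k (ψ i) (a i * x)) := by
    intro i k x
    rw [iteratedDeriv_const_mul_field,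
      iteratedDeriv_comp_const_mul ((hψ i).of_le (mod_cast le_top))]
  let v : ℕ → ℕ → ℝ := fun k i =>
    if k < i then (1 / 2) ^ i else ((a i)⁻¹) ^ i * ((a i) ^ k * M i k)
  have hv : ∀ k, Summable (v k) := by
    intro k
    have h1 : Summable fun i : ℕ => ((1 : ℝ) / 2) ^ i := summable_geometric_two
    refine h1.congr_cofinite ?_
    rw [Nat.cofinite_eq_atTop]
    filter_upwards [eventually_gt_atTop k] with i hi
    simp [v, hi]
  have hbound : ∀ k i x, ‖iteratedFDeriv ℝ k (φ i) x‖ ≤ v k i := by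
    intro k i x
    rw [norm_iteratedFDeriv_eq_norm_iteratedDeriv, hφd, norm_mul, norm_mul, norm_pow, norm_pow,
      Real.norm_of_nonneg (ha0 i).le, Real.norm_of_nonneg (inv_pos.2 (ha0 i)).le]
    have h1 : (a i)⁻¹ ^ i * ((a i) ^ k * ‖iteratedDeriv k (ψ i) (a i * x)‖) ≤
        (a i)⁻¹ ^ i * ((a i) ^ k * M i k) := by
      have := ha0 i
      gcongr
      exact hM i k _
    refine h1.trans ?_
    simp only [v]
    split_ifs with hk
    · refine le_trans ?_ (haM i k hk)
      obtain ⟨d, rfl⟩ := Nat.exists_eq_add_of_lt hk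
      have h2 : ∀ α m : ℝ, α ≠ 0 →
          α⁻¹ ^ (k + d + 1) * (α ^ k * m) = α⁻¹ ^ d * (α⁻¹ * m) := by
        intro α m hα
        rw [pow_succ, pow_add, inv_pow, inv_pow]
        field_simp
      rw [h2 _ _ (ha0 _).ne']
      have h3 : (a (k + d + 1))⁻¹ ^ d ≤ 1 :=
        pow_le_one₀ (inv_pos.2 (ha0 _)).le (inv_le_one_of_one_le₀ (ha1 _))
      exact mul_le_of_le_one_left (mul_nonneg (inv_pos.2 (ha0 _)).le (hM0 _ _)) h3
    · exact le_rfl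
  refine ⟨fun x => ∑' i, φ i x, contDiff_tsum (N := ⊤) hφ (fun k _ => hv k)
    (fun k i x _ => hbound k i x), fun k => ?_⟩
  rw [iteratedDeriv_eq_iteratedFDeriv,
    iteratedFDeriv_tsum_apply (N := ⊤) hφ (fun k _ => hv k) (fun k i x _ => hbound k i x) le_top]
  have hs : Summable fun i => iteratedFDeriv ℝ k (φ i) 0 :=
    .of_norm_bounded (hv k) fun i => hbound k i 0
  have h0 : ∀ i, iteratedDeriv k (φ i) 0 = if i = k then c k else 0 := by
    intro i
    rw [hφd, mul_zero]
    have h1 : ψ i =ᶠ[𝓝 0] fun u => (c i / i.factorial) * u ^ i := by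
      filter_upwards [χ.eventuallyEq_one] with u hu
      simp [ψ, hu]
    rw [h1.iteratedDeriv_eq, iteratedDeriv_const_mul_field, iteratedDeriv_fun_pow_zero]
    by_cases hik : k = i
    · subst hik
      have := (ha0 k).ne'
      have h2 : (k.factorial : ℝ) ≠ 0 := by positivity
      simp
      field_simp
    · simp [hik, Ne.symm hik]
  have h2 := (ContinuousMultilinearMap.apply ℝ (fun _ : Fin k => ℝ) ℝ (fun _ => 1)).map_tsum hs
  simp only [ContinuousMultilinearMap.apply_apply] at h2
  rw [h2]
  simp only [← iteratedDeriv_eq_iteratedFDeriv, h0]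
  rw [tsum_ite_eq]

theorem contDiff_indicator_Ici_of_iteratedDerivWithin_eq_zero (n : ℕ) :
    ∀ {h : ℝ → ℝ}, ContDiffOn ℝ (⊤ : ℕ∞) h (Ici 0) →
      (∀ k, iteratedDerivWithin k h (Ici 0) 0 = 0) → ContDiff ℝ n ((Ici 0).indicator h) := by
  have key : ∀ {h : ℝ → ℝ}, ContDiffOn ℝ (⊤ : ℕ∞) h (Ici 0) →
      (∀ k, iteratedDerivWithin k h (Ici 0) 0 = 0) → ∀ x,
      HasDerivAt ((Ici 0).indicator h) ((Ici 0).indicator (derivWithin h (Ici 0)) x) x := by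
    intro h hs h0 x
    have hd : DifferentiableOn ℝ h (Ici 0) := hs.differentiableOn (by simp)
    rcases lt_trichotomy x 0 with hx | rfl | hx
    · rw [indicator_of_notMem (by simpa using hx)]
      refine (hasDerivAt_const x (0 : ℝ)).congr_of_eventuallyEq ?_
      filter_upwards [Iio_mem_nhds hx] with y hy
      exact indicator_of_notMem (by simpa using hy) _
    · rw [indicator_of_mem (by simp)]
      have h1 : derivWithin h (Ici 0) 0 = 0 := by simpa using h0 1
      have h2 : h 0 = 0 := by simpa using h0 0
      have hr : HasDerivWithinAt ((Ici 0).indicator h) (derivWithin h (Ici 0) 0) (Ici 0) 0 :=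
        (hd 0 (by simp)).hasDerivWithinAt.congr (fun y hy => indicator_of_mem hy _) (by simp)
      have hl : HasDerivWithinAt ((Ici 0).indicator h) (derivWithin h (Ici 0) 0) (Iic 0) 0 := by
        rw [h1]
        refine (hasDerivWithinAt_const 0 _ (0 : ℝ)).congr (fun y hy => ?_) (by simp [h2])
        rcases (mem_Iic.1 hy).lt_or_eq with hy | rfl
        · exact indicator_of_notMem (by simpa using hy) _
        · simp [h2]
      have := hl.union hr
      rwa [Iic_union_Ici, hasDerivWithinAt_univ] at this
    · rw [indicator_of_mem (by simpa using hx.le)]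
      refine ((hd x hx.le).hasDerivWithinAt.hasDerivAt (Ici_mem_nhds hx)).congr_of_eventuallyEq ?_
      filter_upwards [Ioi_mem_nhds hx] with y hy
      exact indicator_of_mem (le_of_lt (mem_Ioi.1 hy)) _
  induction n with
  | zero =>
    intro h hs h0
    exact contDiff_zero.2 (Differentiable.continuous fun x => (key hs h0 x).differentiableAt)
  | succ n ih =>
    intro h hs h0
    push_cast
    refine contDiff_succ_iff_deriv.2 ⟨fun x => (key hs h0 x).differentiableAt, by simp, ?_⟩
    rw [funext fun x => (key hs h0 x).deriv]
    exact ih ((contDiffOn_infty_iff_derivWithin (uniqueDiffOn_Ici 0)).1 hs).2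
      fun k => by rw [← iteratedDerivWithin_succ']; exact h0 (k + 1)

/-- A function that is smooth on `[0, ∞)` extends to a smooth function on `ℝ`. -/
theorem ContDiffOn.exists_contDiff_eqOn_Ici {f : ℝ → ℝ} (hf : ContDiffOn ℝ (⊤ : ℕ∞) f (Ici 0)) :
    ∃ g : ℝ → ℝ, ContDiff ℝ (⊤ : ℕ∞) g ∧ EqOn g f (Ici 0) := by
  obtain ⟨b, hb, hbk⟩ :=
    exists_contDiff_iteratedDeriv_eq fun k => iteratedDerivWithin k f (Ici 0) 0
  have hu : UniqueDiffOn ℝ (Ici (0 : ℝ)) := uniqueDiffOn_Ici 0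
  refine ⟨b + (Ici 0).indicator (f - b), hb.add (contDiff_infty.2 fun n =>
    contDiff_indicator_Ici_of_iteratedDerivWithin_eq_zero n (hf.sub hb.contDiffOn) fun k => ?_),
    fun x hx => by simp [indicator_of_mem hx]⟩
  have hk : ((k : ℕ∞) : WithTop ℕ∞) ≤ ((⊤ : ℕ∞) : WithTop ℕ∞) := mod_cast le_top
  rw [iteratedDerivWithin_sub self_mem_Ici hu ((hf 0 self_mem_Ici).of_le hk)
    (hb.contDiffOn.of_le hk 0 self_mem_Ici),
    iteratedDerivWithin_eq_iteratedDeriv hu (hb.contDiffAt.of_le hk) self_mem_Ici, hbk, sub_self]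

theorem ContDiffOn.exists_contDiff_euclidean_eqOn_Ici {ι : Type*} [Fintype ι]
    {f : ℝ → EuclideanSpace ℝ ι} (hf : ContDiffOn ℝ (⊤ : ℕ∞) f (Ici 0)) :
    ∃ g : ℝ → EuclideanSpace ℝ ι, ContDiff ℝ (⊤ : ℕ∞) g ∧ EqOn g f (Ici 0) := by
  choose g hg hgf using fun i => (contDiffOn_euclidean.1 hf i).exists_contDiff_eqOn_Ici
  refine ⟨fun t => WithLp.toLp 2 fun i => g i t, contDiff_euclidean.2 hg, fun t ht => ?_⟩
  ext i
  exact hgf i ht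

section LocalDiffeo

open Filter Topology

variable {E F G : Type*} [NormedAddCommGroup E] [NormedSpace ℝ E] [NormedAddCommGroup F]
  [NormedSpace ℝ F] [NormedAddCommGroup G] [NormedSpace ℝ G]

/-- `f` is smooth at `x` and has a smooth local inverse there. -/
def LocalDiffeoAt (f : E → F) (x : E) : Prop :=
  ContDiffAt ℝ (⊤ : ℕ∞) f x ∧ ∃ g : F → E, ContDiffAt ℝ (⊤ : ℕ∞) g (f x) ∧ g (f x) = x ∧
    (∀ᶠ x' in 𝓝 x, g (f x') = x') ∧ ∀ᶠ y in 𝓝 (f x), f (g y) = y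

theorem LocalDiffeoAt.id (x : E) : LocalDiffeoAt (fun x : E => x) x :=
  ⟨contDiffAt_id, fun x => x, contDiffAt_id, rfl, by simp, by simp⟩

theorem LocalDiffeoAt.comp {f : E → F} {k : F → G} {x : E} (hk : LocalDiffeoAt k (f x))
    (hf : LocalDiffeoAt f x) : LocalDiffeoAt (fun x => k (f x)) x := by
  obtain ⟨hf, g, hg, hgx, hgf, hfg⟩ := hf
  obtain ⟨hk, l, hl, hlx, hlk, hkl⟩ := hk
  refine ⟨hk.comp x hf, fun z => g (l z), ?_, by simp only [hlx, hgx], ?_, ?_⟩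
  · exact ContDiffAt.comp (k (f x)) (by rwa [hlx]) hl
  · filter_upwards [hgf, hf.continuousAt.eventually hlk] with x' h1 h2
    rw [h2, h1]
  · have hl' := hl.continuousAt
    rw [ContinuousAt, hlx] at hl'
    filter_upwards [hkl, hl'.eventually hfg] with z h1 h2
    rw [h2, h1]

theorem LocalDiffeoAt.congr {f f' : E → F} {x : E} (hf : LocalDiffeoAt f x) (h : f' =ᶠ[𝓝 x] f) :
    LocalDiffeoAt f' x := by
  obtain ⟨hf, g, hg, hgx, hgf, hfg⟩ := hf
  have hx := h.self_of_nhds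
  refine ⟨hf.congr_of_eventuallyEq h, g, by rwa [hx], by rw [hx, hgx], ?_, ?_⟩
  · filter_upwards [h, hgf] with x' h1 h2
    rw [h1, h2]
  · rw [hx]
    have hg' := hg.continuousAt
    rw [ContinuousAt, hgx] at hg'
    filter_upwards [hfg, hg'.eventually h] with y h1 h2
    rw [h2, h1]

theorem ContDiffAt.localDiffeoAt_of_injective [FiniteDimensional ℝ E] [FiniteDimensional ℝ F]
    (hEF : Module.finrank ℝ E = Module.finrank ℝ F) {f : E → F} {f' : E →L[ℝ] F} {x : E}
    (hf : ContDiffAt ℝ (⊤ : ℕ∞) f x) (hf' : HasFDerivAt f f' x)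
    (hinj : ∀ u, f' u = 0 → u = 0) : LocalDiffeoAt f x := by
  have := FiniteDimensional.complete ℝ E
  let e : E ≃L[ℝ] F := (LinearEquiv.ofInjectiveOfFinrankEq (f' : E →ₗ[ℝ] F)
    ((injective_iff_map_eq_zero _).2 hinj) hEF).toContinuousLinearEquiv
  have he : HasFDerivAt f (e : E →L[ℝ] F) x := by
    have : (e : E →L[ℝ] F) = f' := by
      ext u
      rfl
    rwa [this]
  have hs := hf.hasStrictFDerivAt' he (by simp)
  exact ⟨hf, _, hf.to_localInverse he (by simp), hf.localInverse_apply_image he (by simp),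
    hs.eventually_left_inverse, hs.eventually_right_inverse⟩

theorem LocalDiffeoAt.exists_injOn {f : E → F} {x : E} (hf : LocalDiffeoAt f x) :
    ∃ U ∈ 𝓝 x, InjOn f U := by
  obtain ⟨-, g, -, -, h, -⟩ := hf
  exact ⟨_, h, fun a ha b hb hab => by rw [← show g (f a) = a from ha, hab, hb]⟩

theorem LocalDiffeoAt.of_inverse {f : E → F} {g : F → E} {x : E}
    (hf : ContDiffAt ℝ (⊤ : ℕ∞) f x) (hg : ContDiffAt ℝ (⊤ : ℕ∞) g (f x))
    (hgf : ∀ x, g (f x) = x) (hfg : ∀ y, f (g y) = y) : LocalDiffeoAt f x :=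
  ⟨hf, g, hg, hgf x, by simp [hgf], by simp [hfg]⟩

end LocalDiffeo

section Model

open Filter Topology

/-- The standard closed ray in `ℝ × ℂ`. -/
def modelRay : Set (ℝ × ℂ) := {x | 0 ≤ x.1 ∧ x.2 = 0}

theorem isClosed_modelRay : IsClosed modelRay :=
  (isClosed_le continuous_const continuous_fst).inter
    (isClosed_eq continuous_snd continuous_const)

/-- The displacement along the first coordinate used to push `ℝ × ℂ` minus the standard ray onto
`ℝ × ℂ`. -/
noncomputable def pushDisplacement (δ : ℝ) (x : ℝ × ℂ) : ℝ :=
  Real.smoothTransition (1 - ‖x.2‖ ^ 2) * Real.smoothTransition (x.1 + δ) /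
    (‖x.2‖ ^ 2 + expNegInvGlue (-x.1))

theorem pushDisplacement_denom_pos {x : ℝ × ℂ} (hx : x ∉ modelRay) :
    0 < ‖x.2‖ ^ 2 + expNegInvGlue (-x.1) := by
  by_cases h : x.2 = 0
  · have : x.1 < 0 := by
      by_contra! h'
      exact hx ⟨h', h⟩
    have := expNegInvGlue.pos_of_pos (neg_pos.2 this)
    positivity
  · have := expNegInvGlue.nonneg (-x.1)
    have := norm_pos_iff.2 h
    positivity

theorem pushDisplacement_nonneg (δ : ℝ) (x : ℝ × ℂ) : 0 ≤ pushDisplacement δ x :=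
  div_nonneg (mul_nonneg (Real.smoothTransition.nonneg _) (Real.smoothTransition.nonneg _))
    (add_nonneg (by positivity) (expNegInvGlue.nonneg _))

theorem contDiffAt_pushDisplacement (δ : ℝ) {x : ℝ × ℂ} (hx : x ∉ modelRay) :
    ContDiffAt ℝ (⊤ : ℕ∞) (pushDisplacement δ) x := by
  have h1 : ContDiff ℝ (⊤ : ℕ∞) fun x : ℝ × ℂ => ‖x.2‖ ^ 2 := contDiff_snd.norm_sq ℝ
  refine ContDiffAt.div (ContDiffAt.mul ?_ ?_) ?_ (pushDisplacement_denom_pos hx).ne'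
  · exact (Real.smoothTransition.contDiff.comp (contDiff_const.sub h1)).contDiffAt
  · exact (Real.smoothTransition.contDiff.comp (contDiff_fst.add contDiff_const)).contDiffAt
  · exact (h1.add (expNegInvGlue.contDiff.comp contDiff_fst.neg)).contDiffAt

theorem pushDisplacement_mono (δ : ℝ) {s t : ℝ} {w : ℂ} (hst : s ≤ t) (ht : (t, w) ∉ modelRay) :
    pushDisplacement δ (s, w) ≤ pushDisplacement δ (t, w) := by
  have h0 := pushDisplacement_denom_pos ht
  have h1 : expNegInvGlue (-t) ≤ expNegInvGlue (-s) := expNegInvGlue.monotone (by linarith)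
  have h2 := Real.smoothTransition.monotone (show s + δ ≤ t + δ by linarith)
  have h3 := Real.smoothTransition.nonneg (1 - ‖w‖ ^ 2)
  have h4 := Real.smoothTransition.nonneg (t + δ)
  simp only [pushDisplacement] at h0 ⊢
  gcongr

/-- The map pushing the standard ray to infinity. -/
noncomputable def pushMap (δ : ℝ) (x : ℝ × ℂ) : ℝ × ℂ := (x.1 + pushDisplacement δ x, x.2)

theorem localDiffeoAt_pushMap (δ : ℝ) {x : ℝ × ℂ} (hx : x ∉ modelRay) :
    LocalDiffeoAt (pushMap δ) x := by
  have hτ := contDiffAt_pushDisplacement δ hx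
  have hτ' := (hτ.differentiableAt (by simp)).hasFDerivAt
  refine ContDiffAt.localDiffeoAt_of_injective rfl ((contDiffAt_fst.add hτ).prodMk contDiffAt_snd)
    ((hasFDerivAt_fst.add hτ').prodMk hasFDerivAt_snd) ?_
  rintro ⟨a, u⟩ hu
  simp only [ContinuousLinearMap.prod_apply, add_apply, ContinuousLinearMap.coe_fst',
    ContinuousLinearMap.coe_snd', Prod.mk_eq_zero] at hu
  obtain ⟨h1, rfl⟩ := hu
  have h2 : HasDerivAt (fun t : ℝ => pushDisplacement δ (t, x.2))
      (fderiv ℝ (pushDisplacement δ) x (1, 0)) x.1 := by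
    have h3 : HasDerivAt (fun t : ℝ => (t, x.2)) ((1 : ℝ), (0 : ℂ)) x.1 :=
      (hasDerivAt_id x.1).prodMk (hasDerivAt_const _ _)
    exact HasFDerivAt.comp_hasDerivAt x.1 (f := fun t : ℝ => (t, x.2)) hτ' h3
  have h4 : 0 ≤ fderiv ℝ (pushDisplacement δ) x (1, 0) := by
    refine ge_of_tendsto (hasDerivAt_iff_tendsto_slope_left_right.1 h2).1 ?_
    filter_upwards [self_mem_nhdsWithin] with s hs
    rw [slope_def_field]
    have := pushDisplacement_mono δ (le_of_lt hs) hx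
    exact div_nonneg_of_nonpos (by linarith) (by linarith [mem_Iio.1 hs])
  have h5 : fderiv ℝ (pushDisplacement δ) x (a, 0) =
      a * fderiv ℝ (pushDisplacement δ) x (1, 0) := by
    rw [← smul_eq_mul, ← map_smul]
    simp
  rw [h5] at h1
  have h6 : a * (1 + fderiv ℝ (pushDisplacement δ) x (1, 0)) = 0 := by linarith
  rcases mul_eq_zero.1 h6 with h | h
  · rw [h]; rfl
  · linarith

theorem pushMap_injOn (δ : ℝ) : InjOn (pushMap δ) modelRayᶜ := by
  have key : ∀ {s t : ℝ} {w : ℂ}, (t, w) ∉ modelRay → s < t →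
      (pushMap δ (s, w)).1 < (pushMap δ (t, w)).1 := fun ht hst => by
    have := pushDisplacement_mono δ hst.le ht
    simp only [pushMap]
    linarith
  rintro ⟨s, w⟩ hs ⟨t, w'⟩ ht h
  obtain rfl : w = w' := congrArg Prod.snd h
  rcases lt_trichotomy s t with hst | rfl | hst
  · exact absurd (congrArg Prod.fst h) (key ht hst).ne
  · rfl
  · exact absurd (congrArg Prod.fst h) (key hs hst).ne'

theorem pushMap_eq_self {δ : ℝ} {x : ℝ × ℂ} (hx : ¬ (-δ ≤ x.1 ∧ ‖x.2‖ ≤ 1)) :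
    pushMap δ x = x := by
  have : pushDisplacement δ x = 0 := by
    simp only [pushDisplacement, div_eq_zero_iff, mul_eq_zero,
      Real.smoothTransition.zero_iff_nonpos]
    left
    by_contra! h
    exact hx ⟨by linarith [h.2], by nlinarith [h.1, norm_nonneg x.2]⟩
  simp [pushMap, this]

theorem pushMap_surjOn {δ : ℝ} (hδ : 0 < δ) : SurjOn (pushMap δ) modelRayᶜ univ := by
  rintro ⟨s, w⟩ -
  have cont : ∀ {t : ℝ}, (t, w) ∉ modelRay →
      ContinuousAt (fun t : ℝ => t + pushDisplacement δ (t, w)) t := fun {t} ht =>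
    continuousAt_id.add (ContinuousAt.comp (f := fun t : ℝ => (t, w))
      (contDiffAt_pushDisplacement δ ht).continuousAt (by fun_prop))
  suffices h : ∃ a b, (∀ t ∈ Icc a b, (t, w) ∉ modelRay) ∧ a ≤ b ∧
      a + pushDisplacement δ (a, w) ≤ s ∧ s ≤ b + pushDisplacement δ (b, w) by
    obtain ⟨a, b, hab, hle, ha, hb⟩ := h
    obtain ⟨t, ht, hts⟩ := intermediate_value_Icc hle
      (fun t ht => (cont (hab t ht)).continuousWithinAt) ⟨ha, hb⟩
    exact ⟨(t, w), hab t ht, by simpa [pushMap] using hts⟩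
  have hlow : ∀ a, a < -δ → pushDisplacement δ (a, w) = 0 := fun a ha => by
    have := congrArg Prod.fst (pushMap_eq_self (δ := δ) (x := (a, w))
      (fun h => absurd h.1 (not_le.2 ha)))
    simpa [pushMap] using this
  by_cases hw : w = 0
  · subst hw
    have hlim : Tendsto (fun t : ℝ => (t + pushDisplacement δ (t, 0))) (𝓝[<] 0) atTop := by
      have hnum : Tendsto (fun t : ℝ => Real.smoothTransition (1 - ‖(0 : ℂ)‖ ^ 2) *
          Real.smoothTransition (t + δ)) (𝓝[<] 0)
          (𝓝 (Real.smoothTransition (1 - ‖(0 : ℂ)‖ ^ 2) * Real.smoothTransition (0 + δ))) := by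
        refine tendsto_nhdsWithin_of_tendsto_nhds (Continuous.tendsto ?_ 0)
        exact continuous_const.mul (Real.smoothTransition.continuous.comp (by fun_prop))
      have hden : Tendsto (fun t : ℝ => (‖(0 : ℂ)‖ ^ 2 + expNegInvGlue (-t))) (𝓝[<] 0)
          (𝓝[>] 0) := by
        refine tendsto_nhdsWithin_iff.2 ⟨tendsto_nhdsWithin_of_tendsto_nhds ?_, ?_⟩
        · have : Continuous fun t : ℝ => ‖(0 : ℂ)‖ ^ 2 + expNegInvGlue (-t) :=
            continuous_const.add
              ((expNegInvGlue.contDiff (n := 0)).continuous.comp continuous_neg)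
          simpa using this.tendsto 0
        · filter_upwards [self_mem_nhdsWithin] with t ht
          exact pushDisplacement_denom_pos (x := (t, 0)) fun h => absurd h.1 (not_le.2 ht)
      have hpos : 0 < Real.smoothTransition (1 - ‖(0 : ℂ)‖ ^ 2) *
          Real.smoothTransition (0 + δ) :=
        mul_pos (Real.smoothTransition.pos_of_pos (by simp))
          (Real.smoothTransition.pos_of_pos (by simpa using hδ))
      have hd := hnum.pos_mul_atTop hpos (tendsto_inv_nhdsGT_zero.comp hden)
      exact (tendsto_nhdsWithin_of_tendsto_nhds (continuous_id.tendsto (0 : ℝ))).add_atTop hd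
    obtain ⟨b, hb, hb0, hbm⟩ := ((hlim.eventually_ge_atTop s).and
      ((eventually_mem_nhdsWithin).and (mem_nhdsWithin_of_mem_nhds
        (Ioi_mem_nhds (show min (s - 1) (-δ - 1) < 0 by
          exact (min_le_right _ _).trans_lt (by linarith)))))).exists
    refine ⟨min (s - 1) (-δ - 1), b, fun t ht h => absurd (h.1.trans ht.2) (not_le.2 hb0),
      le_of_lt hbm, ?_, hb⟩
    rw [hlow _ ((min_le_right _ _).trans_lt (by linarith))]
    linarith [min_le_left (s - 1) (-δ - 1)]
  · refine ⟨min s (-δ - 1), s, fun t _ h => hw h.2, min_le_left _ _, ?_,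
      le_add_of_nonneg_right (pushDisplacement_nonneg _ _)⟩
    rw [hlow _ ((min_le_right _ _).trans_lt (by linarith)), add_zero]
    exact min_le_left _ _

open scoped Manifold ContDiff in
theorem exists_smooth_tube_radius {N : Set (ℝ × ℂ)} (hN : IsOpen N) (hRN : modelRay ⊆ N) :
    ∃ δ > 0, ∃ ε : ℝ → ℝ, ContDiff ℝ (⊤ : ℕ∞) ε ∧ (∀ t, 0 < ε t) ∧
      ∀ t w, -δ ≤ t → ‖w‖ ≤ ε t → (t, w) ∈ N := by
  obtain ⟨δ, hδ, hδN⟩ : ∃ δ > 0, ∀ t, -δ ≤ t → (t, (0 : ℂ)) ∈ N := by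
    obtain ⟨r, hr, hrN⟩ := Metric.isOpen_iff.1 hN (0, 0) (hRN ⟨le_rfl, rfl⟩)
    refine ⟨r / 2, half_pos hr, fun t ht => ?_⟩
    rcases le_or_gt 0 t with h | h
    · exact hRN ⟨h, rfl⟩
    · refine hrN ?_
      rw [Metric.mem_ball, Prod.dist_eq, dist_self, max_lt_iff, Real.dist_eq, sub_zero,
        abs_of_neg h]
      exact ⟨by linarith, hr⟩
  let K : ℝ → Set ℝ := fun t => {r | 0 < r ∧ (-δ ≤ t → ∀ w : ℂ, ‖w‖ ≤ r → (t, w) ∈ N)}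
  have hK : ∀ t, Convex ℝ (K t) := fun t => by
    refine Set.OrdConnected.convex ⟨fun a ha b hb c hc => ⟨ha.1.trans_le hc.1, fun ht w hw => ?_⟩⟩
    exact hb.2 ht w (hw.trans hc.2)
  have hloc : ∀ t, ∃ c, ∀ᶠ s in 𝓝 t, c ∈ K s := by
    intro t
    rcases lt_or_ge t (-δ) with h | h
    · refine ⟨1, ?_⟩
      filter_upwards [Iio_mem_nhds h] with s hs
      exact ⟨one_pos, fun h' => absurd h' (not_le.2 hs)⟩
    · obtain ⟨r, hr, hrN⟩ := Metric.isOpen_iff.1 hN (t, 0) (hδN t h)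
      refine ⟨r / 2, ?_⟩
      filter_upwards [Metric.ball_mem_nhds t hr] with s hs
      refine ⟨half_pos hr, fun _ w hw => hrN ?_⟩
      rw [Metric.mem_ball, Prod.dist_eq, max_lt_iff, dist_zero_right]
      exact ⟨hs, by simpa using hw.trans_lt (half_lt_self hr)⟩
  obtain ⟨g, hg⟩ := exists_contMDiffMap_forall_mem_convex_of_local_const (I := 𝓘(ℝ, ℝ))
    (n := (⊤ : ℕ∞)) hK hloc
  exact ⟨δ, hδ, g, g.contMDiff.contDiff, fun t => (hg t).1, fun t w ht hw => (hg t).2 ht w hw⟩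

theorem exists_pushMap_supported {N : Set (ℝ × ℂ)} (hN : IsOpen N) (hRN : modelRay ⊆ N) :
    ∃ (θ : ℝ × ℂ → ℝ × ℂ) (C : Set (ℝ × ℂ)), IsClosed C ∧ modelRay ⊆ C ∧ C ⊆ N ∧
      BijOn θ modelRayᶜ univ ∧ (∀ x ∉ modelRay, LocalDiffeoAt θ x) ∧ ∀ x ∉ C, θ x = x := by
  obtain ⟨δ, hδ, ε, hε, hε0, hεN⟩ := exists_smooth_tube_radius hN hRN
  let S : ℝ × ℂ → ℝ × ℂ := fun x => (x.1, ε x.1 • x.2)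
  let T : ℝ × ℂ → ℝ × ℂ := fun x => (x.1, (ε x.1)⁻¹ • x.2)
  have hS : ContDiff ℝ (⊤ : ℕ∞) S :=
    contDiff_fst.prodMk ((hε.comp contDiff_fst).smul contDiff_snd)
  have hT : ContDiff ℝ (⊤ : ℕ∞) T :=
    contDiff_fst.prodMk (((hε.comp contDiff_fst).inv fun x => (hε0 _).ne').smul contDiff_snd)
  have hST : ∀ x, S (T x) = x := fun x => by
    simp only [S, T, smul_smul, mul_inv_cancel₀ (hε0 x.1).ne', one_smul]
  have hTS : ∀ x, T (S x) = x := fun x => by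
    simp only [S, T, smul_smul, inv_mul_cancel₀ (hε0 x.1).ne', one_smul]
  have hTR : ∀ x, T x ∈ modelRay ↔ x ∈ modelRay := fun x => by
    simp [T, modelRay, (hε0 x.1).ne']
  refine ⟨fun x => S (pushMap δ (T x)), {x | -δ ≤ x.1 ∧ ‖x.2‖ ≤ ε x.1}, ?_, ?_, ?_, ⟨?_, ?_, ?_⟩,
    ?_, ?_⟩
  · exact (isClosed_le continuous_const continuous_fst).inter
      (isClosed_le continuous_snd.norm (hε.continuous.comp continuous_fst))
  · rintro ⟨t, w⟩ ⟨ht, hw⟩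
    simp only at ht hw
    subst hw
    exact ⟨by simp only; linarith, by simpa using (hε0 t).le⟩
  · exact fun x hx => hεN _ _ hx.1 hx.2
  · exact fun _ _ => mem_univ _
  · intro x hx y hy hxy
    have h1 := congrArg T hxy
    simp only [hTS] at h1
    have h2 := congrArg S (pushMap_injOn δ (mt (hTR x).1 hx) (mt (hTR y).1 hy) h1)
    simpa only [hST] using h2
  · intro y _
    obtain ⟨x, hx, hxy⟩ := pushMap_surjOn hδ (mem_univ (T y))
    exact ⟨S x, mt (hTR _).2 (by rwa [hTS]), by simp only [hTS, hxy, hST]⟩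
  · intro x hx
    refine LocalDiffeoAt.comp (k := S) ?_ (LocalDiffeoAt.comp (k := pushMap δ) ?_ ?_)
    · exact .of_inverse hS.contDiffAt hT.contDiffAt hTS hST
    · exact localDiffeoAt_pushMap δ (mt (hTR x).1 hx)
    · exact .of_inverse hT.contDiffAt hS.contDiffAt hST hTS
  · intro x hx
    simp only
    rw [pushMap_eq_self, hST]
    contrapose! hx
    refine ⟨hx.1, ?_⟩
    have := hx.2
    simp only [T, norm_smul, norm_inv, Real.norm_of_nonneg (hε0 x.1).le] at this
    rwa [inv_mul_le_iff₀ (hε0 _), mul_one] at this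

end Model

section Neighborhood

open Filter Topology

theorem exists_lipschitz_injectivity_radius {Z Y : Type*} [MetricSpace Z] (f : Z → Y) (A : Set Z)
    (hloc : ∀ a ∈ A, ∃ U ∈ 𝓝 a, InjOn f U) :
    ∃ r : Z → ℝ, (∀ a ∈ A, 0 < r a) ∧ (∀ a, r a ≤ 1) ∧ (∀ a, InjOn f (Metric.ball a (r a))) ∧
      ∀ a b, r b ≤ r a + dist a b := by
  let R : Z → Set ℝ := fun a => {s | s ≤ 1 ∧ InjOn f (Metric.ball a s)}
  have hbdd : ∀ a, BddAbove (R a) := fun a => ⟨1, fun s hs => hs.1⟩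
  have h0 : ∀ a, (0 : ℝ) ∈ R a := fun a => ⟨zero_le_one, by simp⟩
  have hne : ∀ a, (R a).Nonempty := fun a => ⟨0, h0 a⟩
  refine ⟨fun a => sSup (R a), fun a ha => ?_, fun a => csSup_le (hne a) fun s hs => hs.1,
    fun a x hx y hy hxy => ?_, fun a b => csSup_le (hne b) fun s hs => ?_⟩
  · obtain ⟨U, hU, hUf⟩ := hloc a ha
    obtain ⟨s, hs, hsU⟩ := Metric.mem_nhds_iff.1 hU
    refine (lt_min hs one_pos).trans_le (le_csSup (hbdd a) ⟨min_le_right _ _, ?_⟩)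
    exact hUf.mono ((Metric.ball_subset_ball (min_le_left _ _)).trans hsU)
  · obtain ⟨s, hs, hxys⟩ := exists_lt_of_lt_csSup (hne a)
      (max_lt (Metric.mem_ball.1 hx) (Metric.mem_ball.1 hy))
    exact hs.2 ((le_max_left _ _).trans_lt hxys) ((le_max_right _ _).trans_lt hxys) hxy
  · have : s - dist a b ∈ R a := by
      refine ⟨by linarith [hs.1, dist_nonneg (x := a) (y := b)], hs.2.mono ?_⟩
      exact Metric.ball_subset_ball' (by linarith)
    linarith [le_csSup (hbdd a) this]

/-- A continuous map that restricts to a closed embedding of `A`, and is locally injective at the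
points of `A`, is injective on some open neighbourhood `N` of `A`, and is a closed map on closed
subsets of `N`. -/
theorem exists_isOpen_injOn_isClosed_image {Z Y : Type*} [MetricSpace Z] [ProperSpace Z]
    [MetricSpace Y] [ProperSpace Y] {f : Z → Y} (hf : Continuous f) {A : Set Z} (hA : InjOn f A)
    (hproper : ∀ K, IsCompact K → IsCompact (A ∩ f ⁻¹' K))
    (hloc : ∀ a ∈ A, ∃ U ∈ 𝓝 a, InjOn f U) :
    ∃ N, IsOpen N ∧ A ⊆ N ∧ InjOn f N ∧ ∀ C ⊆ N, IsClosed C → IsClosed (f '' C) := by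
  obtain ⟨r, hr0, hr1, hrf, hrL⟩ := exists_lipschitz_injectivity_radius f A hloc
  have hκ : ∀ a : Z, ∃ κ : ℝ, 0 < κ ∧ κ ≤ 1 ∧
      (a ∈ A → ∀ b ∈ A, dist (f a) (f b) < 2 * κ → dist a b < r a / 2) := by
    intro a
    by_cases ha : a ∈ A
    · have hK : IsCompact (f '' ((A ∩ f ⁻¹' Metric.closedBall (f a) 2) \ Metric.ball a (r a / 2))) :=
        ((hproper _ (isCompact_closedBall _ _)).diff Metric.isOpen_ball).image hf
      have haK : f a ∉ f '' ((A ∩ f ⁻¹' Metric.closedBall (f a) 2) \ Metric.ball a (r a / 2)) := by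
        rintro ⟨b, ⟨⟨hbA, -⟩, hb⟩, hba⟩
        rw [hA hbA ha hba] at hb
        exact hb (Metric.mem_ball_self (half_pos (hr0 a ha)))
      obtain ⟨s, hs, hsK⟩ := Metric.isOpen_iff.1 hK.isClosed.isOpen_compl (f a) haK
      refine ⟨min (s / 2) 1, lt_min (half_pos hs) one_pos, min_le_right _ _,
        fun _ b hb hab => ?_⟩
      have h1 : dist (f b) (f a) < s := by
        rw [dist_comm]
        linarith [min_le_left (s / 2) 1]
      have h2 : dist (f b) (f a) ≤ 2 := by
        rw [dist_comm]
        linarith [min_le_right (s / 2) 1]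
      by_contra! h
      refine hsK h1 ⟨b, ⟨⟨hb, h2⟩, fun h' => ?_⟩, rfl⟩
      rw [Metric.mem_ball, dist_comm] at h'
      linarith
    · exact ⟨1, one_pos, le_rfl, fun h => absurd h ha⟩
  choose κ hκ0 hκ1 hκ using hκ
  have hη : ∀ a : Z, ∃ η > 0, ∀ x, dist x a < η → dist (f x) (f a) < κ a := fun a =>
    Metric.continuous_iff.1 hf a (κ a) (hκ0 a)
  choose η hη0 hη using hη
  have memN : ∀ x, x ∈ ⋃ a ∈ A, Metric.ball a (min (η a) (r a / 4)) →
      ∃ a ∈ A, dist x a < r a / 4 ∧ dist (f x) (f a) < κ a := by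
    intro x hx
    simp only [mem_iUnion, Metric.mem_ball, lt_min_iff] at hx
    obtain ⟨a, ha, h1, h2⟩ := hx
    exact ⟨a, ha, h2, hη a x h1⟩
  have inj : ∀ x x' a a', a ∈ A → a' ∈ A → dist x a < r a / 4 → dist x' a' < r a' / 4 →
      dist (f x) (f a) < κ a → dist (f x') (f a') < κ a' → κ a' ≤ κ a → f x = f x' → x = x' := by
    intro x x' a a' ha ha' hx hx' hfx hfx' hκκ hxx'
    have h1 : dist (f a) (f a') < 2 * κ a := by
      have := dist_triangle (f a) (f x) (f a')
      rw [dist_comm (f a) (f x)] at this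
      rw [← hxx'] at hfx'
      linarith
    have h2 := hκ a ha a' ha' h1
    have h3 := hrL a a'
    have h4 := dist_triangle x' a' a
    rw [dist_comm a' a] at h4
    have h5 := hr0 a ha
    exact hrf a (show dist x a < r a by linarith) (show dist x' a < r a by linarith) hxx'
  refine ⟨⋃ a ∈ A, Metric.ball a (min (η a) (r a / 4)),
    isOpen_biUnion fun a _ => Metric.isOpen_ball, fun a ha => ?_, fun x hx x' hx' hxx' => ?_,
    fun C hCN hC => ?_⟩
  · exact mem_biUnion ha (Metric.mem_ball_self (lt_min (hη0 a) (by linarith [hr0 a ha])))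
  · obtain ⟨a, ha, h1, h2⟩ := memN x hx
    obtain ⟨a', ha', h1', h2'⟩ := memN x' hx'
    rcases le_total (κ a') (κ a) with h | h
    · exact inj x x' a a' ha ha' h1 h1' h2 h2' h hxx'
    · exact (inj x' x a' a ha' ha h1' h1 h2' h2 h hxx'.symm).symm
  · refine isClosed_of_closure_subset fun y hy => ?_
    have hD : IsCompact (C ∩ Metric.cthickening 1 (A ∩ f ⁻¹' Metric.closedBall y 2)) :=
      (hproper _ (isCompact_closedBall y 2)).cthickening.inter_left hC
    suffices h : y ∈ closure
        (f '' (C ∩ Metric.cthickening 1 (A ∩ f ⁻¹' Metric.closedBall y 2))) by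
      rw [(hD.image hf).isClosed.closure_eq] at h
      exact image_mono inter_subset_left h
    rw [Metric.mem_closure_iff] at hy ⊢
    intro e he
    obtain ⟨-, ⟨x, hx, rfl⟩, hxy⟩ := hy (min e 1) (lt_min he one_pos)
    rw [lt_min_iff] at hxy
    refine ⟨f x, ⟨x, ⟨hx, ?_⟩, rfl⟩, hxy.1⟩
    obtain ⟨a, ha, h1, h2⟩ := memN x (hCN hx)
    refine Metric.mem_cthickening_of_dist_le x a 1 _ ⟨ha, ?_⟩ (by linarith [hr1 a])
    rw [mem_preimage, Metric.mem_closedBall]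
    have := dist_triangle (f a) (f x) y
    rw [dist_comm (f a) (f x), dist_comm (f x) y] at this
    linarith [hκ1 a]

end Neighborhood

section Tube

open Filter Topology

/-- The cross product with a fixed vector of `EuclideanSpace ℝ (Fin 3)` on the right. -/
noncomputable def crossRight (v : EuclideanSpace ℝ (Fin 3)) :
    EuclideanSpace ℝ (Fin 3) →L[ℝ] EuclideanSpace ℝ (Fin 3) :=
  LinearMap.toContinuousLinearMap ((WithLp.linearEquiv 2 ℝ (Fin 3 → ℝ)).symm.toLinearMap ∘ₗ
    (crossProduct (R := ℝ)).flip v.ofLp ∘ₗ (WithLp.linearEquiv 2 ℝ (Fin 3 → ℝ)).toLinearMap)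

theorem ofLp_crossRight (v p : EuclideanSpace ℝ (Fin 3)) :
    (crossRight v p).ofLp = crossProduct p.ofLp v.ofLp := rfl

theorem eq_zero_of_smul_add_smul_add_smul_crossRight_eq_zero {p v : EuclideanSpace ℝ (Fin 3)}
    (hp : p ≠ 0) (hv : ∀ s : ℝ, s • p ≠ v) {a b c : ℝ}
    (h : a • p + b • v + c • crossRight v p = 0) : a = 0 ∧ b = 0 ∧ c = 0 := by
  have hli : LinearIndependent ℝ ![p.ofLp, v.ofLp] := by
    refine (LinearIndependent.pair_iff' (by simpa using hp)).2 fun s hs => hv s ?_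
    ext i
    exact congrFun hs i
  have hc0 := crossProduct_ne_zero_iff_linearIndependent.2 hli
  have h' : a • p.ofLp + b • v.ofLp + c • crossProduct p.ofLp v.ofLp = 0 := by
    have := congrArg WithLp.ofLp h
    simpa [ofLp_crossRight] using this
  have hc : c = 0 := by
    have h1 := congrArg (fun x => x ⬝ᵥ crossProduct p.ofLp v.ofLp) h'
    simp only [add_dotProduct, smul_dotProduct, dot_self_cross, dot_cross_self, mul_zero,
      zero_add, zero_dotProduct, smul_eq_mul, mul_eq_zero, dotProduct_self_eq_zero] at h1
    exact h1.resolve_right hc0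
  subst hc
  rw [zero_smul, add_zero] at h'
  obtain ⟨rfl, rfl⟩ := LinearIndependent.pair_iff.1 hli a b h'
  exact ⟨rfl, rfl, rfl⟩

theorem exists_forall_smul_deriv_ne {g : ℝ → EuclideanSpace ℝ (Fin 3)}
    (hg : ContDiff ℝ (⊤ : ℕ∞) g) : ∃ v, ∀ s t : ℝ, s • deriv g t ≠ v := by
  have hg' : ContDiff ℝ 1 (deriv g) :=
    ((contDiff_infty_iff_deriv.1 hg).2).of_le (by exact_mod_cast le_top)
  have hd := ContDiff.dense_compl_range_of_finrank_lt_finrank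
    (f := fun x : ℝ × ℝ => x.1 • deriv g x.2) (contDiff_fst.smul (hg'.comp contDiff_snd))
    (by simp)
  obtain ⟨v, hv⟩ := hd.nonempty
  exact ⟨v, fun s t h => hv ⟨(s, t), h⟩⟩

/-- A smooth curve, immersed on `[0, ∞)`, is the core of a tube that is a local diffeomorphism along
the standard ray. -/
theorem exists_tube {g : ℝ → EuclideanSpace ℝ (Fin 3)} (hg : ContDiff ℝ (⊤ : ℕ∞) g)
    (hg0 : ∀ t, 0 ≤ t → deriv g t ≠ 0) :
    ∃ f : ℝ × ℂ → EuclideanSpace ℝ (Fin 3), ContDiff ℝ (⊤ : ℕ∞) f ∧ (∀ t, f (t, 0) = g t) ∧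
      ∀ x ∈ modelRay, LocalDiffeoAt f x := by
  obtain ⟨v, hv⟩ := exists_forall_smul_deriv_ne hg
  have hg' : ContDiff ℝ (⊤ : ℕ∞) (deriv g) := (contDiff_infty_iff_deriv.1 hg).2
  let c : ℝ → EuclideanSpace ℝ (Fin 3) := fun t => crossRight v (deriv g t)
  have hc : ContDiff ℝ (⊤ : ℕ∞) c := (crossRight v).contDiff.comp hg'
  let f : ℝ × ℂ → EuclideanSpace ℝ (Fin 3) := fun x => g x.1 + x.2.re • v + x.2.im • c x.1
  have hre : ContDiff ℝ (⊤ : ℕ∞) fun x : ℝ × ℂ => x.2.re :=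
    Complex.reCLM.contDiff.comp contDiff_snd
  have him : ContDiff ℝ (⊤ : ℕ∞) fun x : ℝ × ℂ => x.2.im :=
    Complex.imCLM.contDiff.comp contDiff_snd
  have hf : ContDiff ℝ (⊤ : ℕ∞) f :=
    ((hg.comp contDiff_fst).add (hre.smul contDiff_const)).add (him.smul (hc.comp contDiff_fst))
  refine ⟨f, hf, fun t => by simp [f], ?_⟩
  rintro ⟨t, w⟩ ⟨ht, hw⟩
  simp only at ht hw
  subst hw
  have hd1 : HasFDerivAt (fun x : ℝ × ℂ => g x.1)
      ((ContinuousLinearMap.fst ℝ ℝ ℂ).smulRight (deriv g t)) (t, (0 : ℂ)) := by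
    have h1 : HasFDerivAt g (ContinuousLinearMap.toSpanSingleton ℝ (deriv g t)) (t, (0 : ℂ)).1 :=
      (hg.differentiable (by simp) t).hasDerivAt.hasFDerivAt
    refine (h1.comp (t, (0 : ℂ)) hasFDerivAt_fst).congr_fderiv ?_
    ext <;> simp
  have hd2 : HasFDerivAt (fun x : ℝ × ℂ => x.2.re • v)
      ((Complex.reCLM.comp (ContinuousLinearMap.snd ℝ ℝ ℂ)).smulRight v) (t, (0 : ℂ)) :=
    ((Complex.reCLM.comp (ContinuousLinearMap.snd ℝ ℝ ℂ)).smulRight v).hasFDerivAt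
  have hd3 : HasFDerivAt (fun x : ℝ × ℂ => x.2.im • c x.1)
      ((Complex.imCLM.comp (ContinuousLinearMap.snd ℝ ℝ ℂ)).smulRight (c t)) (t, (0 : ℂ)) := by
    have h1 : HasFDerivAt (fun x : ℝ × ℂ => x.2.im)
      (Complex.imCLM.comp (ContinuousLinearMap.snd ℝ ℝ ℂ)) (t, (0 : ℂ)) :=
      (Complex.imCLM.comp (ContinuousLinearMap.snd ℝ ℝ ℂ)).hasFDerivAt
    have h2 := ((hc.comp (contDiff_fst (E := ℝ) (F := ℂ))).differentiable (by simp)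
      (t, 0)).hasFDerivAt
    refine (h1.smul h2).congr_fderiv ?_
    simp
  refine hf.contDiffAt.localDiffeoAt_of_injective (by simp) ((hd1.add hd2).add hd3) ?_
  rintro ⟨a, u⟩ hu
  obtain ⟨h1, h2, h3⟩ := eq_zero_of_smul_add_smul_add_smul_crossRight_eq_zero (hg0 t ht)
    (fun s => hv s t) (a := a) (b := u.re) (c := u.im) (by simpa using hu)
  rw [h1, Complex.ext (z := u) (w := 0) h2 h3]
  rfl

end Tube

section Gluing

open Filter Topology

variable {E F G : Type*} [NormedAddCommGroup E] [NormedSpace ℝ E] [NormedAddCommGroup F]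
  [NormedSpace ℝ F] [NormedAddCommGroup G] [NormedSpace ℝ G]

theorem LocalDiffeoAt.of_comp {f : E → F} {k : F → G} {x : E}
    (hkf : LocalDiffeoAt (fun x => k (f x)) x) (hf : LocalDiffeoAt f x) :
    LocalDiffeoAt k (f x) := by
  obtain ⟨hf, g, hg, hgx, hgf, hfg⟩ := hf
  have hg' : LocalDiffeoAt g (f x) := by
    refine ⟨hg, f, by rwa [hgx], by rw [hgx], hfg, ?_⟩
    rwa [hgx]
  refine LocalDiffeoAt.congr (LocalDiffeoAt.comp (f := g) (k := fun x => k (f x))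
    (by rwa [hgx]) hg') ?_
  filter_upwards [hfg] with y hy
  rw [hy]

theorem LocalDiffeoAt.eventually [FiniteDimensional ℝ E] [FiniteDimensional ℝ F]
    (hEF : Module.finrank ℝ E = Module.finrank ℝ F) {f : E → F} (hf : ContDiff ℝ (⊤ : ℕ∞) f)
    {x : E} (hx : LocalDiffeoAt f x) : ∀ᶠ x' in 𝓝 x, LocalDiffeoAt f x' := by
  obtain ⟨-, g, hg, -, hgf, -⟩ := hx
  have hd := hf.differentiable (by simp)
  have hinj : Function.Injective (fderiv ℝ f x) := by
    have h1 : HasFDerivAt (fun x => g (f x)) ((fderiv ℝ g (f x)).comp (fderiv ℝ f x)) x :=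
      (hg.differentiableAt (by simp)).hasFDerivAt.comp x (hd x).hasFDerivAt
    have h2 : HasFDerivAt (fun x => g (f x)) (ContinuousLinearMap.id ℝ E) x :=
      (hasFDerivAt_id x).congr_of_eventuallyEq hgf
    have h3 := h1.unique h2
    exact Function.LeftInverse.injective fun u => DFunLike.congr_fun h3 u
  have ho : IsOpen {L : E →L[ℝ] F | Function.Injective L} := ContinuousLinearMap.isOpen_injective
  have hc : Continuous (fderiv ℝ f) := hf.continuous_fderiv (by simp)
  filter_upwards [hc.continuousAt.eventually (ho.mem_nhds hinj)] with x' hx'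
  exact hf.contDiffAt.localDiffeoAt_of_injective hEF (hd x').hasFDerivAt
    fun u hu => hx' (hu.trans (map_zero _).symm)

/-- A bijection from an open set onto the whole space that is a local diffeomorphism at each point
of the set is a diffeomorphism. -/
theorem setDiffeo_univ_of_localDiffeoAt
    {k : EuclideanSpace ℝ (Fin 3) → EuclideanSpace ℝ (Fin 3)} {M : Set (EuclideanSpace ℝ (Fin 3))}
    (hM : IsOpen M) (hk : BijOn k M univ) (hloc : ∀ y ∈ M, LocalDiffeoAt k y) :
    SetDiffeo M univ := by
  have hinv := hk.invOn_invFunOn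
  have hmaps : ∀ z, Function.invFunOn k M z ∈ M := fun z =>
    Function.invFunOn_mem (hk.surjOn (mem_univ z))
  refine ⟨k, Function.invFunOn k M, fun y hy => (hloc y hy).1.contDiffWithinAt, fun z _ => ?_,
    hk.image_eq, ?_, hinv.1, hinv.2⟩
  · have hz := hinv.2 (mem_univ z)
    obtain ⟨-, g, hg, hgy, -, hkg⟩ := hloc _ (hmaps z)
    rw [hz] at hg hgy hkg
    refine (hg.congr_of_eventuallyEq ?_).contDiffWithinAt
    have hgM : ∀ᶠ z' in 𝓝 z, g z' ∈ M :=
      hg.continuousAt.eventually (by rw [hgy]; exact hM.mem_nhds (hmaps z))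
    filter_upwards [hgM, hkg] with z' h1 h2
    exact hk.injOn (hmaps z') h1 ((hinv.2 (mem_univ z')).trans h2.symm)
  · refine subset_antisymm (image_subset_iff.2 fun z _ => hmaps z) fun y hy => ?_
    exact ⟨k y, mem_univ _, hinv.1 hy⟩

/-- Transplanting self-maps `θ i` of the model, supported in `C i` and opening up the standard ray,
along disjoint embedded tubes `f i`. -/
theorem setDiffeo_compl_iUnion_of_tubes {ι : Type*} {f : ι → ℝ × ℂ → EuclideanSpace ℝ (Fin 3)}
    {θ : ι → ℝ × ℂ → ℝ × ℂ} {N C : ι → Set (ℝ × ℂ)} (hN : ∀ i, IsOpen (N i))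
    (hf : ∀ i, ∀ x ∈ N i, LocalDiffeoAt (f i) x)
    (hinj : ∀ i j, ∀ x ∈ N i, ∀ x' ∈ N j, f i x = f j x' → i = j ∧ x = x')
    (hRC : ∀ i, modelRay ⊆ C i) (hCN : ∀ i, C i ⊆ N i)
    (hclosed : IsClosed (⋃ i, f i '' C i)) (hclosed' : IsClosed (⋃ i, f i '' modelRay))
    (hθ : ∀ i, BijOn (θ i) modelRayᶜ univ)
    (hθd : ∀ i, ∀ x ∉ modelRay, LocalDiffeoAt (θ i) x) (hθC : ∀ i, ∀ x ∉ C i, θ i x = x) :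
    SetDiffeo (⋃ i, f i '' modelRay)ᶜ univ := by
  classical
  let k : EuclideanSpace ℝ (Fin 3) → EuclideanSpace ℝ (Fin 3) := fun y =>
    if h : ∃ p : ι × (ℝ × ℂ), p.2 ∈ C p.1 ∧ f p.1 p.2 = y then f h.choose.1 (θ h.choose.1 h.choose.2) else y
  have hkC : ∀ i, ∀ x ∈ C i, k (f i x) = f i (θ i x) := by
    intro i x hx
    have h : ∃ p : ι × (ℝ × ℂ), p.2 ∈ C p.1 ∧ f p.1 p.2 = f i x := ⟨(i, x), hx, rfl⟩
    have h1 : h.choose = (i, x) := by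
      obtain ⟨h1, h2⟩ := hinj _ _ _ (hCN _ h.choose_spec.1) _ (hCN _ hx) h.choose_spec.2
      exact Prod.ext h1 h2
    simp only [k, dif_pos h]
    rw [h1]
  have hk_of_notMem : ∀ y ∉ ⋃ i, f i '' C i, k y = y := by
    intro y hy
    refine dif_neg ?_
    rintro ⟨p, hp, rfl⟩
    exact hy (mem_iUnion.2 ⟨p.1, mem_image_of_mem _ hp⟩)
  have hkN : ∀ i, ∀ x ∈ N i, k (f i x) = f i (θ i x) := by
    intro i x hx
    by_cases hxC : x ∈ C i
    · exact hkC i x hxC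
    · rw [hθC i x hxC]
      refine hk_of_notMem _ fun h => ?_
      obtain ⟨j, x', hx', h⟩ := mem_iUnion.1 h
      obtain ⟨rfl, rfl⟩ := hinj _ _ _ (hCN _ hx') _ hx h
      exact hxC hx'
  have hθmem : ∀ i, ∀ x ∈ C i, x ∉ modelRay → θ i x ∈ C i := by
    intro i x hx hxR
    by_contra h
    have := (hθ i).injOn (fun h' => h (hRC i h')) hxR (hθC i _ h)
    exact h (this.symm ▸ hx)
  have hmem : ∀ y, y ∈ (⋃ i, f i '' C i) ∨ y ∉ ⋃ i, f i '' C i := fun y => em _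
  have hRsub : (⋃ i, f i '' modelRay) ⊆ ⋃ i, f i '' C i :=
    iUnion_mono fun i => image_mono (hRC i)
  have hkmem : ∀ y ∈ ⋃ i, f i '' C i, y ∉ ⋃ i, f i '' modelRay → ∃ i, ∃ x ∈ C i, x ∉ modelRay ∧
      f i x = y ∧ k y = f i (θ i x) ∧ θ i x ∈ C i := by
    intro y hy hyR
    obtain ⟨i, x, hx, rfl⟩ := mem_iUnion.1 hy
    have hxR : x ∉ modelRay := fun h => hyR (mem_iUnion.2 ⟨i, mem_image_of_mem _ h⟩)
    exact ⟨i, x, hx, hxR, rfl, hkC i x hx, hθmem i x hx hxR⟩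
  refine setDiffeo_univ_of_localDiffeoAt (k := k) hclosed'.isOpen_compl
    ⟨fun _ _ => mem_univ _, fun y hy y' hy' hyy' => ?_, fun z _ => ?_⟩ fun y hy => ?_
  · rcases hmem y with h | h <;> rcases hmem y' with h' | h'
    · obtain ⟨i, x, hx, hxR, rfl, hk, hθx⟩ := hkmem y h hy
      obtain ⟨j, x', hx', hxR', rfl, hk', hθx'⟩ := hkmem y' h' hy'
      rw [hk, hk'] at hyy'
      obtain ⟨rfl, h3⟩ := hinj _ _ _ (hCN _ hθx) _ (hCN _ hθx') hyy'
      rw [(hθ i).injOn hxR hxR' h3]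
    · obtain ⟨i, x, hx, hxR, rfl, hk, hθx⟩ := hkmem y h hy
      rw [hk, hk_of_notMem _ h'] at hyy'
      exact absurd (mem_iUnion.2 ⟨i, mem_image_of_mem _ hθx⟩) (hyy' ▸ h')
    · obtain ⟨i, x, hx, hxR, rfl, hk, hθx⟩ := hkmem y' h' hy'
      rw [hk, hk_of_notMem _ h] at hyy'
      exact absurd (mem_iUnion.2 ⟨i, mem_image_of_mem _ hθx⟩) (hyy' ▸ h)
    · rwa [hk_of_notMem _ h, hk_of_notMem _ h'] at hyy'
  · rcases hmem z with h | h
    · obtain ⟨i, x, hx, rfl⟩ := mem_iUnion.1 h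
      obtain ⟨u, hu, hux⟩ := (hθ i).surjOn (mem_univ x)
      have huC : u ∈ C i := by
        by_contra h'
        rw [hθC i u h'] at hux
        exact h' (hux ▸ hx)
      refine ⟨f i u, fun h' => ?_, by rw [hkC i u huC, hux]⟩
      obtain ⟨j, v, hv, hvu⟩ := mem_iUnion.1 h'
      obtain ⟨rfl, rfl⟩ := hinj _ _ _ (hCN _ (hRC _ hv)) _ (hCN _ huC) hvu
      exact hu hv
    · exact ⟨z, fun h' => h (hRsub h'), hk_of_notMem z h⟩
  · rcases hmem y with h | h
    · obtain ⟨i, x, hx, hxR, rfl, hk, hθx⟩ := hkmem y h hy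
      have hfx := hf i x (hCN i hx)
      refine LocalDiffeoAt.of_comp (LocalDiffeoAt.congr
        (LocalDiffeoAt.comp (hf i _ (hCN i hθx)) (hθd i x hxR)) ?_) hfx
      filter_upwards [(hN i).mem_nhds (hCN i hx)] with x' hx'
      exact hkN i x' hx'
    · refine (LocalDiffeoAt.id y).congr ?_
      filter_upwards [hclosed.isOpen_compl.mem_nhds h] with y' hy'
      exact hk_of_notMem y' hy'

end Gluing

theorem derivWithin_Ici_eq_deriv {F : Type*} [NormedAddCommGroup F] [NormedSpace ℝ F]
    {f g : ℝ → F} (hg : Differentiable ℝ g) (h : EqOn g f (Ici 0)) {t : ℝ} (ht : t ∈ Ici (0 : ℝ)) :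
    derivWithin f (Ici 0) t = deriv g t := by
  rw [← derivWithin_congr h (h ht)]
  exact (hg t).derivWithin (uniqueDiffOn_Ici 0 t ht)

theorem exists_metricSpace_discrete_proper (ι : Type*) [Countable ι] :
    ∃ _ : MetricSpace ι, DiscreteTopology ι ∧ ProperSpace ι := by
  obtain ⟨e, he⟩ := exists_injective_nat ι
  let m : MetricSpace ι := MetricSpace.induced e he inferInstance
  have hee : Topology.IsEmbedding e := ⟨⟨rfl⟩, he⟩
  refine ⟨m, hee.discreteTopology, ⟨fun i r => Set.Finite.isCompact ?_⟩⟩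
  exact (isCompact_closedBall (e i) r).finite_of_discrete.preimage he.injOn

/-- The complement of a smooth proper multiray `L ⊆ ℝ³` with countably many components is
diffeomorphic to ℝ³. -/
theorem compl_multiray_diffeo_R3
    (ι : Type*) [Countable ι] (ρ : ι → ℝ → EuclideanSpace ℝ (Fin 3))
    (h_inj : ∀ i, Set.InjOn (ρ i) (Set.Ici 0))
    (h_smooth : ∀ i, ContDiffOn ℝ (⊤ : ℕ∞) (ρ i) (Set.Ici 0))
    (h_deriv : ∀ i, ∀ t ∈ Set.Ici (0 : ℝ), derivWithin (ρ i) (Set.Ici 0) t ≠ 0)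
    (h_proper : ∀ i, IsProperMap fun t : Set.Ici (0 : ℝ) => ρ i (t : ℝ))
    (h_disj : Pairwise fun i j => Disjoint (ρ i '' Set.Ici 0) (ρ j '' Set.Ici 0))
    (h_locfin : ∀ K : Set (EuclideanSpace ℝ (Fin 3)), IsCompact K →
      {i : ι | ((ρ i '' Set.Ici 0) ∩ K).Nonempty}.Finite) :
    SetDiffeo (⋃ i, ρ i '' Set.Ici 0)ᶜ Set.univ := by
  choose g hg hgρ using fun i => (h_smooth i).exists_contDiff_euclidean_eqOn_Ici
  have hg0 : ∀ i t, 0 ≤ t → deriv (g i) t ≠ 0 := fun i t ht => by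
    rw [← derivWithin_Ici_eq_deriv ((hg i).differentiable (by simp)) (hgρ i) ht]
    exact h_deriv i t ht
  choose f hf hfg hfd using fun i => exists_tube (hg i) (hg0 i)
  have hfρ : ∀ i t, 0 ≤ t → f i (t, 0) = ρ i t := fun i t ht => (hfg i t).trans (hgρ i ht)
  have himage : ∀ i, f i '' modelRay = ρ i '' Ici 0 := by
    intro i
    ext y
    constructor
    · rintro ⟨⟨t, w⟩, ⟨ht, rfl : w = 0⟩, rfl⟩
      exact ⟨t, ht, (hfρ i t ht).symm⟩
    · rintro ⟨t, ht, rfl⟩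
      exact ⟨(t, 0), ⟨ht, rfl⟩, hfρ i t ht⟩
  obtain ⟨_, _, _⟩ := exists_metricSpace_discrete_proper ι
  have hcont : Continuous fun z : ι × (ℝ × ℂ) => f z.1 z.2 :=
    continuous_prod_of_discrete_left.2 fun i => (hf i).continuous
  obtain ⟨N, hN, hRN, hNinj, hNclosed⟩ : ∃ N, IsOpen N ∧ {z : ι × (ℝ × ℂ) | z.2 ∈ modelRay} ⊆ N ∧
      InjOn (fun z : ι × (ℝ × ℂ) => f z.1 z.2) N ∧
      ∀ C ⊆ N, IsClosed C → IsClosed ((fun z : ι × (ℝ × ℂ) => f z.1 z.2) '' C) := by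
    refine exists_isOpen_injOn_isClosed_image hcont ?_ ?_ ?_
    · rintro ⟨i, t, w⟩ ⟨ht, rfl : w = 0⟩ ⟨j, s, w⟩ ⟨hs, rfl : w = 0⟩ h
      simp only [hfρ i t ht, hfρ j s hs] at h
      obtain rfl : i = j := by
        by_contra hij
        exact disjoint_left.1 (h_disj hij) ⟨t, ht, rfl⟩ ⟨s, hs, h.symm⟩
      exact Prod.ext rfl (Prod.ext (h_inj i ht hs h) rfl)
    · intro K hK
      have hT : ∀ i, IsCompact ((fun t : Ici (0 : ℝ) => (i, ((t : ℝ), (0 : ℂ)))) ''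
          ((fun t : Ici (0 : ℝ) => ρ i t) ⁻¹' K)) := fun i =>
        ((h_proper i).isCompact_preimage hK).image (by fun_prop)
      refine (congrArg IsCompact (Set.ext ?_)).mpr
        ((h_locfin K hK).isCompact_biUnion fun i _ => hT i)
      rintro ⟨i, t, w⟩
      simp only [mem_inter_iff, mem_ofPred_eq, mem_preimage, mem_iUnion, mem_image]
      constructor
      · rintro ⟨⟨ht, rfl : w = 0⟩, h⟩
        rw [hfρ i t ht] at h
        exact ⟨i, ⟨ρ i t, ⟨t, ht, rfl⟩, h⟩, ⟨t, ht⟩, h, rfl⟩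
      · rintro ⟨j, -, t, h, h'⟩
        cases h'
        exact ⟨⟨t.2, rfl⟩, by rwa [hfρ i t t.2]⟩
    · rintro ⟨i, x⟩ hx
      obtain ⟨U, hU, hUf⟩ := (hfd i x hx).exists_injOn
      refine ⟨{i} ×ˢ U, prod_mem_nhds (by simp [nhds_discrete]) hU, ?_⟩
      rintro ⟨_, y⟩ ⟨rfl, hy⟩ ⟨_, y'⟩ ⟨rfl, hy'⟩ h
      exact Prod.ext rfl (hUf hy hy' h)
  let N' : ι → Set (ℝ × ℂ) := fun i => {x | (i, x) ∈ N} ∩ interior {x | LocalDiffeoAt (f i) x}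
  have hN' : ∀ i, IsOpen (N' i) := fun i =>
    (hN.preimage (Continuous.prodMk_right i)).inter isOpen_interior
  have hRN' : ∀ i, modelRay ⊆ N' i := fun i x hx =>
    ⟨hRN hx, mem_interior_iff_mem_nhds.2 ((hfd i x hx).eventually (by simp) (hf i))⟩
  choose θ C hC hRC hCN hθ hθd hθC using fun i => exists_pushMap_supported (hN' i) (hRN' i)
  have hclosed : ∀ D : ι → Set (ℝ × ℂ), (∀ i, IsClosed (D i)) → (∀ i, D i ⊆ N' i) →
      IsClosed (⋃ i, f i '' D i) := by
    intro D hD hDN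
    have h1 : IsClosed {z : ι × (ℝ × ℂ) | z.2 ∈ D z.1} := by
      refine isOpen_compl_iff.1 (isOpen_iff_mem_nhds.2 fun z hz => ?_)
      filter_upwards [prod_mem_nhds (show {z.1} ∈ nhds z.1 by simp [nhds_discrete])
        ((hD z.1).isOpen_compl.mem_nhds hz)]
      rintro ⟨_, x⟩ ⟨rfl, hx⟩
      exact hx
    have h2 := hNclosed {z : ι × (ℝ × ℂ) | z.2 ∈ D z.1} (fun z hz => (hDN z.1 hz).1) h1
    convert h2 using 1
    ext y
    simp
  rw [← iUnion_congr himage]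
  exact setDiffeo_compl_iUnion_of_tubes hN' (fun i x hx => mem_ofPred.1 (interior_subset hx.2))
    (fun i j x hx x' hx' h => Prod.ext_iff.1 (hNinj (x₁ := (i, x)) (x₂ := (j, x')) hx.1 hx'.1 h))
    hRC hCN (hclosed C hC hCN) (hclosed _ (fun _ => isClosed_modelRay) hRN') hθ hθd hθC
end

section
/- Let L be a smooth proper multiray in ℝ³ with countably many components. Then every compact set K ⊆ ℝ³ \ L is contained in an open set U with K ⊆ U ⊆ ℝ³ \ L such that U is diffeomorphic to ℝ³ (i.e., K is contained in a smooth open ball in the complement of L). -/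
open Set

/-- A permutation of a normed space which is a `C^∞` diffeomorphism. -/
def IsSmoothPerm {E : Type*} [NormedAddCommGroup E] [NormedSpace ℝ E] (φ : Equiv.Perm E) : Prop :=
  ContDiff ℝ (⊤ : ℕ∞) φ ∧ ContDiff ℝ (⊤ : ℕ∞) φ.symm

section NormedSpace

variable {E : Type*} [NormedAddCommGroup E] [NormedSpace ℝ E]

theorem IsSmoothPerm.one : IsSmoothPerm (1 : Equiv.Perm E) :=
  ⟨contDiff_id, contDiff_id⟩

theorem IsSmoothPerm.inv {φ : Equiv.Perm E} (h : IsSmoothPerm φ) : IsSmoothPerm φ⁻¹ :=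
  ⟨h.2, h.1⟩

theorem IsSmoothPerm.mul {φ ψ : Equiv.Perm E} (hφ : IsSmoothPerm φ) (hψ : IsSmoothPerm ψ) :
    IsSmoothPerm (φ * ψ) :=
  ⟨hφ.1.comp hψ.1, hψ.2.comp hφ.2⟩

theorem IsSmoothPerm.pow {φ : Equiv.Perm E} (hφ : IsSmoothPerm φ) (n : ℕ) :
    IsSmoothPerm (φ ^ n) := by
  induction n with
  | zero => exact .one
  | succ n ih => rw [pow_succ]; exact ih.mul hφ

theorem exists_isSmoothPerm_eq_add_of_lipschitzWith [CompleteSpace E] {F : E → E}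
    (hF : ContDiff ℝ (⊤ : ℕ∞) F) {c : NNReal} (hc : c < 1) (hL : LipschitzWith c F) :
    ∃ φ : Equiv.Perm E, IsSmoothPerm φ ∧ ∀ z, φ z = z + F z := by
  have happrox : ApproximatesLinearOn (fun z => z + F z)
      ((ContinuousLinearEquiv.refl ℝ E : E ≃L[ℝ] E) : E →L[ℝ] E) univ c := by
    rw [ApproximatesLinearOn.approximatesLinearOn_iff_lipschitzOnWith, lipschitzOnWith_univ]
    convert hL using 1
    ext z
    simp
  have hcond : Subsingleton E ∨ c < ‖((ContinuousLinearEquiv.refl ℝ E).symm : E →L[ℝ] E)‖₊⁻¹ := by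
    rcases subsingleton_or_nontrivial E with h | h
    · exact .inl h
    · right
      have : ‖((ContinuousLinearEquiv.refl ℝ E).symm : E →L[ℝ] E)‖₊ = 1 := by
        ext
        simp
      rw [this, inv_one]
      exact hc
  let φ : E ≃ₜ E := happrox.toHomeomorph _ hcond
  have hφ : ∀ z, φ z = z + F z := fun z => rfl
  have hφs : ContDiff ℝ (⊤ : ℕ∞) φ := contDiff_id.add hF
  have hnorm (a : E) : ‖-fderiv ℝ F a‖ < 1 := by
    rw [norm_neg]
    exact (norm_fderiv_le_of_lipschitz ℝ hL).trans_lt hc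
  refine ⟨φ.toEquiv, ⟨hφs, φ.contDiff_symm
    (f₀' := fun a => ContinuousLinearEquiv.unitsEquiv ℝ E (Units.oneSub _ (hnorm a))) ?_ hφs⟩, hφ⟩
  intro a
  have h := (hasFDerivAt_id a).add (hF.differentiable (by simp) a).hasFDerivAt
  convert h using 1
  · ext v
    exact hφ v
  · ext v
    simp

/-- The shear `z ↦ z - q (ℓ z)` along the fibres of `ℓ`. -/
theorem exists_isSmoothPerm_shear (ℓ : E →L[ℝ] ℝ) {q : ℝ → E} (hq : ContDiff ℝ (⊤ : ℕ∞) q)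
    (hℓq : ∀ x, ℓ (q x) = 0) :
    ∃ S : Equiv.Perm E, IsSmoothPerm S ∧ (∀ z, S z = z - q (ℓ z)) ∧
      ∀ z, S⁻¹ z = z + q (ℓ z) := by
  refine ⟨⟨fun z => z - q (ℓ z), fun z => z + q (ℓ z), fun z => ?_, fun z => ?_⟩,
    ⟨?_, ?_⟩, fun z => rfl, fun z => rfl⟩
  · simp [hℓq]
  · simp [hℓq]
  · exact contDiff_id.sub (hq.comp ℓ.contDiff)
  · exact contDiff_id.add (hq.comp ℓ.contDiff)

end NormedSpace

section FiniteDimensional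

variable {E : Type*} [NormedAddCommGroup E] [NormedSpace ℝ E] [FiniteDimensional ℝ E]

theorem exists_contDiff_bump {C O : Set E} (hC : IsCompact C) (hO : IsOpen O) (hCO : C ⊆ O) :
    ∃ χ : E → ℝ, ContDiff ℝ (⊤ : ℕ∞) χ ∧ HasCompactSupport χ ∧ (∀ z ∈ C, χ z = 1) ∧
      (∀ z ∉ O, χ z = 0) ∧ ∀ z, χ z ∈ Icc (0 : ℝ) 1 := by
  have : ProperSpace E := FiniteDimensional.proper_real E
  obtain ⟨R, hR⟩ := hC.isBounded.subset_ball 0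
  obtain ⟨χ, h0, h1, hχ⟩ := exists_contMDiffMap_zero_one_of_isClosed (n := (⊤ : ℕ∞))
    (modelWithCornersSelf ℝ E) (s := (O ∩ Metric.ball 0 R)ᶜ) (t := C)
    (hO.inter Metric.isOpen_ball).isClosed_compl hC.isClosed
    (disjoint_left.2 fun z hz hzC => hz ⟨hCO hzC, hR hzC⟩)
  refine ⟨χ, χ.contMDiff.contDiff, ?_, h1, fun z hz => h0 fun h => hz h.1, hχ⟩
  refine HasCompactSupport.of_support_subset_isCompact (isCompact_closedBall (0 : E) R) ?_
  intro z hz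
  by_contra h
  exact hz (h0 fun h' => h (Metric.ball_subset_closedBall h'.2))

/-- A thin cylinder around a straight segment can be pushed towards one of its ends by a
diffeomorphism supported near the segment. -/
theorem exists_isSmoothPerm_push (ℓ : E →L[ℝ] ℝ) {e : E} (he : ℓ e = 1) {a b c σ : ℝ}
    (hab : a ≤ b) (hbc : b < c) {O : Set E} (hO : IsOpen O)
    (hCO : ∀ z, ℓ z ∈ Icc a b → ‖z - ℓ z • e‖ ≤ σ → z ∈ O) :
    ∃ ψ : Equiv.Perm E, IsSmoothPerm ψ ∧ (∀ z ∉ O, ψ z = z) ∧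
      ∀ z, ℓ z ∈ Icc a c → ‖z - ℓ z • e‖ ≤ σ →
        ψ z - ℓ (ψ z) • e = z - ℓ z • e ∧ ℓ (ψ z) ∈ Icc b c := by
  have : ProperSpace E := FiniteDimensional.proper_real E
  have hCc : IsCompact {z | ℓ z ∈ Icc a b ∧ ‖z - ℓ z • e‖ ≤ σ} := by
    refine Metric.isCompact_of_isClosed_isBounded ?_ ?_
    · exact (isClosed_Icc.preimage ℓ.continuous).inter
        (isClosed_le (f := fun z => ‖z - ℓ z • e‖) (by fun_prop) continuous_const)
    · refine isBounded_iff_forall_norm_le.2 ⟨σ + max |a| |b| * ‖e‖, fun z hz => ?_⟩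
      calc ‖z‖ = ‖(z - ℓ z • e) + ℓ z • e‖ := by simp
        _ ≤ ‖z - ℓ z • e‖ + ‖ℓ z • e‖ := norm_add_le _ _
        _ ≤ σ + max |a| |b| * ‖e‖ := by
          rw [norm_smul, Real.norm_eq_abs]
          gcongr
          · exact hz.2
          · exact abs_le_max_abs_abs hz.1.1 hz.1.2
  obtain ⟨χ, hχs, hχc, hχ1, hχ0, hχ⟩ := exists_contDiff_bump hCc
    (hO.inter (isOpen_Iio.preimage ℓ.continuous : IsOpen (ℓ ⁻¹' Iio ((b + c) / 2))))
    (fun z hz => ⟨hCO z hz.1 hz.2, show ℓ z < (b + c) / 2 by linarith [hz.1.2]⟩)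
  have hFs : ContDiff ℝ (⊤ : ℕ∞) fun z => χ z • e := hχs.smul contDiff_const
  obtain ⟨D, hD⟩ := hFs.lipschitzWith_of_hasCompactSupport (hχc.smul_right) (by simp)
  obtain ⟨ε, hε0, hεc, hεD⟩ : ∃ ε : NNReal, 0 < ε ∧ (ε : ℝ) ≤ (c - b) / 2 ∧ ε * D < 1 := by
    have hpos : 0 < (c - b) / 2 := by linarith
    refine ⟨min ⟨(c - b) / 2, hpos.le⟩ (D + 1)⁻¹, lt_min hpos (by positivity),
      NNReal.coe_le_coe.2 (min_le_left _ _), ?_⟩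
    calc _ ≤ (D + 1)⁻¹ * D := by gcongr; exact min_le_right _ _
      _ < (D + 1)⁻¹ * (D + 1) := by gcongr; simp
      _ = 1 := inv_mul_cancel₀ (by positivity)
  have hL : LipschitzWith (ε * D) fun z => (ε : ℝ) • (χ z • e) := by
    have h := (lipschitzWith_smul (α := ℝ) (β := E) (ε : ℝ)).comp hD
    rwa [NNReal.nnnorm_eq] at h
  obtain ⟨φ, hφs, hφ⟩ : ∃ φ : Equiv.Perm E, IsSmoothPerm φ ∧ ∀ z, φ z = z + (ε : ℝ) • (χ z • e) :=
    exists_isSmoothPerm_eq_add_of_lipschitzWith (contDiff_const.smul hFs) hεD hL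
  have hℓφ (z : E) : ℓ (φ z) = ℓ z + ε * χ z := by simp [hφ, he]
  have hvφ (z : E) : φ z - ℓ (φ z) • e = z - ℓ z • e := by
    rw [hℓφ, hφ, add_smul, mul_smul]
    abel
  have key (n : ℕ) (z : E) (hz : ℓ z ∈ Icc a c) (hσ : ‖z - ℓ z • e‖ ≤ σ) :
      (φ ^ n) z - ℓ ((φ ^ n) z) • e = z - ℓ z • e ∧ ℓ ((φ ^ n) z) ≤ c ∧
        min b (a + n * ε) ≤ ℓ ((φ ^ n) z) := by
    induction n with
    | zero => simp [hz.1, hz.2]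
    | succ n ih =>
      obtain ⟨h1, h2, h3⟩ := ih
      rw [pow_succ', Equiv.Perm.mul_apply]
      set w := (φ ^ n) z
      have hε0' : (0 : ℝ) < ε := hε0
      refine ⟨(hvφ w).trans h1, ?_, ?_⟩
      · rw [hℓφ]
        by_cases hw : ℓ w < (b + c) / 2
        · nlinarith [(hχ w).2]
        · rw [hχ0 w fun h => hw h.2]
          simpa using h2
      · rw [hℓφ]
        by_cases hw : ℓ w ≤ b
        · have ha : a ≤ ℓ w := (le_min hab (by simp; positivity)).trans h3
          rw [hχ1 w ⟨⟨ha, hw⟩, h1 ▸ hσ⟩]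
          push_cast
          rcases min_le_iff.1 h3 with h | h
          · exact (min_le_left _ _).trans (by linarith)
          · exact (min_le_right _ _).trans (by linarith)
        · have := mul_nonneg hε0'.le (hχ w).1
          exact (min_le_left _ _).trans (by linarith)
  obtain ⟨n, hn⟩ := exists_nat_ge ((b - a) / ε)
  have hn' : b ≤ a + n * ε := by
    rw [div_le_iff₀ (show (0 : ℝ) < ε from hε0)] at hn
    linarith
  have hfix (n : ℕ) (z : E) (hz : z ∉ O) : (φ ^ n) z = z := by
    induction n with
    | zero => rfl
    | succ n ih => rw [pow_succ, Equiv.Perm.mul_apply, hφ, hχ0 z fun h => hz h.1]; simpa using ih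
  refine ⟨φ ^ n, hφs.pow n, hfix n, fun z hz hσ => ?_⟩
  obtain ⟨h1, h2, h3⟩ := key n z hz hσ
  exact ⟨h1, (le_min le_rfl hn').trans h3, h2⟩


theorem exists_contDiff_approx_param {F : Type*} [NormedAddCommGroup F] [NormedSpace ℝ F]
    {x : ℝ → ℝ} {y : ℝ → F} {a c : ℝ} (hx : ContinuousOn x (Icc a c)) (hinj : InjOn x (Icc a c))
    (hy : ContinuousOn y (Icc a c)) {σ : ℝ} (hσ : 0 < σ) :
    ∃ p : ℝ → F, ContDiff ℝ (⊤ : ℕ∞) p ∧ ∀ s ∈ Icc a c, ‖p (x s) - y s‖ < σ := by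
  let t : ℝ → Set F := fun u => {v | ∀ s ∈ Icc a c, x s = u → v ∈ Metric.ball (y s) σ}
  have ht (u : ℝ) : Convex ℝ (t u) := by
    simp only [t, ofPred_forall]
    exact convex_iInter fun s => convex_iInter fun _ => convex_iInter fun _ => convex_ball _ _
  have hloc : ∀ u : ℝ, ∃ v : F, ∀ᶠ w in nhds u, v ∈ t w := by
    intro u
    by_cases hu : u ∈ x '' Icc a c
    · obtain ⟨s₀, hs₀, rfl⟩ := hu
      refine ⟨y s₀, ?_⟩
      have hfar : IsCompact (x '' {s ∈ Icc a c | σ ≤ dist (y s₀) (y s)}) := by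
        have hcl : IsClosed {s ∈ Icc a c | σ ≤ dist (y s₀) (y s)} := by
          have hdist : ContinuousOn (fun s => dist (y s₀) (y s)) (Icc a c) :=
            (continuous_const.dist continuous_id).comp_continuousOn hy
          exact hdist.preimage_isClosed_of_isClosed isClosed_Icc isClosed_Ici
        exact (isCompact_Icc.of_isClosed_subset hcl fun s hs => hs.1).image_of_continuousOn
          (hx.mono fun s hs => hs.1)
      have hmem : (x '' {s ∈ Icc a c | σ ≤ dist (y s₀) (y s)})ᶜ ∈ nhds (x s₀) := by
        refine hfar.isClosed.isOpen_compl.mem_nhds ?_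
        rintro ⟨s, hs, hss⟩
        have : s = s₀ := hinj hs.1 hs₀ hss
        have h2 := hs.2
        rw [this, dist_self] at h2
        exact hσ.not_ge h2
      filter_upwards [hmem] with u hu s hs hsu
      rw [Metric.mem_ball]
      by_contra! h
      exact hu ⟨s, ⟨hs, h⟩, hsu⟩
    · refine ⟨0, ?_⟩
      filter_upwards [(isCompact_Icc.image_of_continuousOn hx).isClosed.isOpen_compl.mem_nhds hu]
        with u hu s hs hsu
      exact absurd ⟨s, hs, hsu⟩ hu
  obtain ⟨p, hp⟩ := exists_contMDiffMap_forall_mem_convex_of_local_const (n := (⊤ : ℕ∞))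
    (modelWithCornersSelf ℝ ℝ) ht hloc
  exact ⟨p, p.contMDiff.contDiff, fun s hs => by simpa [t, dist_eq_norm] using hp (x s) s hs rfl⟩

/-- An arc on which a linear functional is strictly increasing can be retracted towards its
endpoint by a diffeomorphism supported near the part of the arc which has to be moved. -/
theorem exists_isSmoothPerm_retract_arc (ℓ : E →L[ℝ] ℝ) {e : E} (he : ℓ e = 1) {γ : ℝ → E}
    {a b c : ℝ} (hab : a ≤ b) (hbc : b < c) (hγ : ContinuousOn γ (Icc a c))
    (hmono : StrictMonoOn (fun t => ℓ (γ t)) (Icc a c)) {W N : Set E} (hW : IsOpen W)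
    (hN : IsOpen N) (hγW : γ '' Icc a b ⊆ W) (hγN : γ '' Icc b c ⊆ N) :
    ∃ ψ : Equiv.Perm E, IsSmoothPerm ψ ∧ (∀ z ∉ W, ψ z = z) ∧ ∀ t ∈ Icc a c, ψ (γ t) ∈ N := by
  have hac := hab.trans hbc.le
  have hℓγ : ContinuousOn (fun t => ℓ (γ t)) (Icc a c) := ℓ.continuous.comp_continuousOn hγ
  obtain ⟨r₁, hr₁, hrW⟩ := (isCompact_Icc.image_of_continuousOn
    (hγ.mono (Icc_subset_Icc_right hbc.le))).exists_thickening_subset_open hW hγW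
  obtain ⟨r₂, hr₂, hrN⟩ := (isCompact_Icc.image_of_continuousOn
    (hγ.mono (Icc_subset_Icc_left hab))).exists_thickening_subset_open hN hγN
  set σ := min r₁ r₂ / 2
  have hσ : 0 < σ := half_pos (lt_min hr₁ hr₂)
  have hσ₁ : σ + σ ≤ r₁ := by rw [add_halves]; exact min_le_left _ _
  have hσ₂ : σ + σ ≤ r₂ := by rw [add_halves]; exact min_le_right _ _
  let v : E →L[ℝ] E := ContinuousLinearMap.id ℝ E - ℓ.smulRight e
  have hv (z : E) : v z = z - ℓ z • e := rfl
  have hℓv (z : E) : ℓ (v z) = 0 := by simp [hv, he]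
  have hvv (z : E) : v (v z) = v z := by rw [hv (v z), hℓv, zero_smul, sub_zero]
  obtain ⟨p, hp, hpγ⟩ : ∃ p : ℝ → E, ContDiff ℝ (⊤ : ℕ∞) p ∧
      ∀ s ∈ Icc a c, ‖v (p (ℓ (γ s))) - v (γ s)‖ < σ := by
    obtain ⟨p, hp, h⟩ := exists_contDiff_approx_param hℓγ hmono.injOn hγ
      (σ := σ / (‖v‖ + 1)) (by positivity)
    refine ⟨p, hp, fun s hs => ?_⟩
    rw [← map_sub]
    have h1 := h s hs
    rw [lt_div_iff₀ (by positivity)] at h1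
    have h2 := v.le_opNorm (p (ℓ (γ s)) - γ s)
    nlinarith [norm_nonneg (p (ℓ (γ s)) - γ s)]
  obtain ⟨S, hS, hSz, hSz'⟩ := exists_isSmoothPerm_shear ℓ (q := fun u => v (p u))
    (v.contDiff.comp hp) fun u => hℓv _
  have hℓS (z : E) : ℓ (S z) = ℓ z := by rw [hSz, map_sub, hℓv, sub_zero]
  have hvS (z : E) : v (S z) = v z - v (p (ℓ z)) := by rw [hSz, map_sub, hvv]
  have hdist {z : E} {s : ℝ} (hs : s ∈ Icc a c) (hzs : ℓ z = ℓ (γ s)) (hzσ : ‖v z‖ ≤ σ) :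
      dist (S⁻¹ z) (γ s) < σ + σ := by
    have : S⁻¹ z - γ s = v z + (v (p (ℓ (γ s))) - v (γ s)) := by
      rw [hSz', hzs, hv z, hv (γ s), hzs]
      abel
    rw [dist_eq_norm, this]
    exact (norm_add_le _ _).trans_lt (add_lt_add_of_le_of_lt hzσ (hpγ s hs))
  have hSc : Continuous S.symm := hS.2.continuous
  obtain ⟨ψ, hψ, hψW, hψN⟩ := exists_isSmoothPerm_push ℓ he (σ := σ)
    (hmono.monotoneOn ⟨le_rfl, hac⟩ ⟨hab, hbc.le⟩ hab)
    (hmono ⟨hab, hbc.le⟩ ⟨hac, le_rfl⟩ hbc) (hW.preimage hSc) (fun z hz hzσ => by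
      obtain ⟨s, hs, hsz⟩ := intermediate_value_Icc hab
        (hℓγ.mono (Icc_subset_Icc_right hbc.le)) hz
      refine hrW (Metric.mem_thickening_iff.2 ⟨γ s, mem_image_of_mem γ hs, ?_⟩)
      exact (hdist (Icc_subset_Icc_right hbc.le hs) hsz.symm hzσ).trans_le hσ₁)
  refine ⟨S⁻¹ * ψ * S, (hS.inv.mul hψ).mul hS, fun z hz => ?_, fun t ht => ?_⟩
  · rw [Equiv.Perm.mul_apply, Equiv.Perm.mul_apply, hψW]
    · simp
    · simpa using hz
  · have hSt : ‖v (S (γ t))‖ ≤ σ := by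
      rw [hvS, norm_sub_rev]
      exact (hpγ t ht).le
    obtain ⟨h1, h2⟩ := hψN (S (γ t)) (by
      rw [hℓS]
      exact ⟨hmono.monotoneOn ⟨le_rfl, hac⟩ ht ht.1, hmono.monotoneOn ht ⟨hac, le_rfl⟩ ht.2⟩) hSt
    obtain ⟨s, hs, hsz⟩ := intermediate_value_Icc hbc.le (hℓγ.mono (Icc_subset_Icc_left hab)) h2
    refine hrN (Metric.mem_thickening_iff.2 ⟨γ s, mem_image_of_mem γ hs, ?_⟩)
    refine (hdist (z := ψ (S (γ t))) (Icc_subset_Icc_left hab hs) hsz.symm ?_).trans_le hσ₂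
    rw [hv, h1]
    exact hSt

/-- `K` is contained in the preimage of a round ball under a diffeomorphism of the ambient space,
the preimage of the corresponding closed ball being disjoint from `A`. -/
def SmoothlyEngulfed {E : Type*} [NormedAddCommGroup E] [NormedSpace ℝ E] (K A : Set E) : Prop :=
  ∃ φ : Equiv.Perm E, IsSmoothPerm φ ∧ ∃ R : ℝ, 0 < R ∧ (∀ z ∈ K, φ z ∈ Metric.ball 0 R) ∧
    ∀ z ∈ A, φ z ∉ Metric.closedBall 0 R

theorem SmoothlyEngulfed.mono {E : Type*} [NormedAddCommGroup E] [NormedSpace ℝ E] {K A A' : Set E}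
    (h : SmoothlyEngulfed K A) (hA : A' ⊆ A) : SmoothlyEngulfed K A' := by
  obtain ⟨φ, hφ, R, hR, hK, hd⟩ := h
  exact ⟨φ, hφ, R, hR, hK, fun z hz => hd z (hA hz)⟩

theorem SmoothlyEngulfed.extend_arc {K B : Set E} (hK : IsClosed K) (hB : IsClosed B) {γ : ℝ → E}
    (hγ : ContinuousOn γ (Ici 0)) (hinj : InjOn γ (Ici 0))
    (hcl : ∀ c, 0 ≤ c → IsClosed (γ '' Ici c)) (hKγ : Disjoint K (γ '' Ici 0))
    (hBγ : Disjoint B (γ '' Ici 0)) (ℓ : E →L[ℝ] ℝ) {a b c : ℝ} (ha : 0 ≤ a) (hab : a ≤ b)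
    (hbc : b < c) (hmono : StrictMonoOn (fun t => ℓ (γ t)) (Icc a c))
    (h : SmoothlyEngulfed K (B ∪ γ '' Ici b)) : SmoothlyEngulfed K (B ∪ γ '' Ici a) := by
  obtain ⟨φ, hφ, R, hR, hKR, hd⟩ := h
  obtain ⟨e, he⟩ : ∃ e, ℓ e = 1 := by
    have hlt := hmono ⟨le_rfl, hab.trans hbc.le⟩ ⟨hab.trans hbc.le, le_rfl⟩ (hab.trans_lt hbc)
    refine ⟨(ℓ (γ c) - ℓ (γ a))⁻¹ • (γ c - γ a), ?_⟩
    rw [map_smul, map_sub, smul_eq_mul, inv_mul_cancel₀ (sub_pos.2 hlt).ne']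
  have hIcc : Icc a c ⊆ Ici 0 := fun t ht => ha.trans ht.1
  have hc : 0 ≤ c := ha.trans (hab.trans hbc.le)
  obtain ⟨ψ, hψ, hψW, hψN⟩ := exists_isSmoothPerm_retract_arc ℓ he hab hbc (hγ.mono hIcc) hmono
    (W := (K ∪ B ∪ γ '' Ici c)ᶜ) (N := (φ ⁻¹' Metric.closedBall 0 R)ᶜ)
    ((hK.union hB).union (hcl c hc)).isOpen_compl
    (Metric.isClosed_closedBall.preimage hφ.1.continuous).isOpen_compl (by
      rintro _ ⟨t, ht, rfl⟩ ((h | h) | ⟨s, hs, hst⟩)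
      · exact disjoint_left.1 hKγ h ⟨t, ha.trans ht.1, rfl⟩
      · exact disjoint_left.1 hBγ h ⟨t, ha.trans ht.1, rfl⟩
      · have := hinj (hc.trans hs) (ha.trans ht.1) hst
        exact absurd (hbc.trans_le hs) (this ▸ ht.2).not_gt) (by
      rintro _ ⟨t, ht, rfl⟩
      exact hd _ (.inr ⟨t, ht.1, rfl⟩))
  refine ⟨φ * ψ, hφ.mul hψ, R, hR, fun z hz => ?_, ?_⟩
  · rw [Equiv.Perm.mul_apply, hψW z fun h => h (.inl (.inl hz))]
    exact hKR z hz
  · rintro z (hz | ⟨t, ht, rfl⟩)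
    · rw [Equiv.Perm.mul_apply, hψW z fun h => h (.inl (.inr hz))]
      exact hd z (.inl hz)
    · rw [Equiv.Perm.mul_apply]
      rcases le_total t c with htc | htc
      · exact hψN t ⟨ht, htc⟩
      · rw [hψW _ fun h => h (.inr ⟨t, htc, rfl⟩)]
        exact hd _ (.inr ⟨t, hbc.le.trans htc, rfl⟩)

/-- A compact set which can be engulfed away from a tail of a ray can be engulfed away from the
whole ray. -/
theorem SmoothlyEngulfed.extend_ray {K B : Set E} (hK : IsClosed K) (hB : IsClosed B) {γ : ℝ → E}
    (hγ : ContinuousOn γ (Ici 0)) (hinj : InjOn γ (Ici 0))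
    (hcl : ∀ c, 0 ≤ c → IsClosed (γ '' Ici c)) (hKγ : Disjoint K (γ '' Ici 0))
    (hBγ : Disjoint B (γ '' Ici 0))
    (hloc : ∀ a, 0 ≤ a → ∃ ℓ : E →L[ℝ] ℝ, ∃ δ > 0,
      StrictMonoOn (fun t => ℓ (γ t)) (Ici 0 ∩ Ioo (a - δ) (a + δ)))
    {T : ℝ} (hT : 0 ≤ T) (h : SmoothlyEngulfed K (B ∪ γ '' Ici T)) :
    SmoothlyEngulfed K (B ∪ γ '' Ici 0) := by
  refine (isPreconnected_Icc (a := (0 : ℝ)) (b := T)).induction₂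
    (fun s t => SmoothlyEngulfed K (B ∪ γ '' Ici s) ↔ SmoothlyEngulfed K (B ∪ γ '' Ici t))
    (fun x hx => ?_) (fun _ _ _ _ _ _ => Iff.trans) (fun _ _ _ _ => Iff.symm)
    ⟨hT, le_rfl⟩ ⟨le_rfl, hT⟩ |>.1 h
  obtain ⟨ℓ, δ, hδ, hmono⟩ := hloc x hx.1
  have key {s t : ℝ} (hs : 0 ≤ s) (hst : s ≤ t) (hsx : x - δ < s) (htx : t < x + δ) :
      SmoothlyEngulfed K (B ∪ γ '' Ici s) ↔ SmoothlyEngulfed K (B ∪ γ '' Ici t) := by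
    refine ⟨fun h => h.mono (union_subset_union_right _ (image_mono (Ici_subset_Ici.2 hst))),
      fun h => ?_⟩
    obtain ⟨c, htc, hcx⟩ := exists_between htx
    exact h.extend_arc hK hB hγ hinj hcl hKγ hBγ ℓ hs hst htc (hmono.mono fun u hu =>
      ⟨hs.trans hu.1, hsx.trans_le hu.1, hu.2.trans_lt hcx⟩)
  have hnhds : Ioo (x - δ) (x + δ) ∈ nhds x := Ioo_mem_nhds (by linarith) (by linarith)
  filter_upwards [mem_nhdsWithin_of_mem_nhds hnhds, self_mem_nhdsWithin] with y hy hyT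
  rcases le_total x y with hxy | hxy
  · exact key hx.1 hxy (by linarith) hy.2
  · exact (key hyT.1 hxy hy.1 (by linarith)).symm

end FiniteDimensional

theorem isClosed_image_Ici_of_isProperMap {X : Type*} [TopologicalSpace X] {γ : ℝ → X}
    (hγ : IsProperMap fun t : Ici (0 : ℝ) => γ t) {c : ℝ} (hc : 0 ≤ c) :
    IsClosed (γ '' Ici c) := by
  convert hγ.isClosedMap _ (isClosed_Ici.preimage continuous_subtype_val :
    IsClosed ((↑) ⁻¹' Ici c : Set (Ici (0 : ℝ)))) using 1
  ext z
  constructor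
  · rintro ⟨t, ht, rfl⟩
    exact ⟨⟨t, hc.trans ht⟩, ht, rfl⟩
  · rintro ⟨t, ht, rfl⟩
    exact ⟨t, ht, rfl⟩

theorem exists_tail_disjoint_of_isProperMap {X : Type*} [TopologicalSpace X] {γ : ℝ → X}
    (hγ : IsProperMap fun t : Ici (0 : ℝ) => γ t) {C : Set X} (hC : IsCompact C) :
    ∃ T, 0 ≤ T ∧ Disjoint (γ '' Ici T) C := by
  obtain ⟨M, hM⟩ := ((hγ.isCompact_preimage hC).image continuous_subtype_val).bddAbove
  refine ⟨max 0 (M + 1), le_max_left _ _, disjoint_left.2 ?_⟩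
  rintro _ ⟨t, ht, rfl⟩ htC
  have h0 : (0 : ℝ) ≤ t := (le_max_left _ _).trans ht
  have h1 : t ≤ M := hM ⟨⟨t, h0⟩, htC, rfl⟩
  linarith [(le_max_right 0 (M + 1)).trans ht]

/-- Near each parameter, the linear functional dual to the velocity is strictly increasing along a
regular curve. -/
theorem exists_strictMonoOn_of_derivWithin_ne_zero {E : Type*} [NormedAddCommGroup E]
    [InnerProductSpace ℝ E] {γ : ℝ → E} (hγ : ContDiffOn ℝ 1 γ (Ici 0)) {a : ℝ} (ha : 0 ≤ a)
    (hd : derivWithin γ (Ici 0) a ≠ 0) :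
    ∃ ℓ : E →L[ℝ] ℝ, ∃ δ > 0,
      StrictMonoOn (fun t => ℓ (γ t)) (Ici 0 ∩ Ioo (a - δ) (a + δ)) := by
  let ℓ := innerSL ℝ (derivWithin γ (Ici 0) a)
  have hcont : ContinuousOn (fun t => ℓ (derivWithin γ (Ici 0) t)) (Ici 0) :=
    ℓ.continuous.comp_continuousOn (hγ.continuousOn_derivWithin (uniqueDiffOn_Ici 0) le_rfl)
  have hpos : 0 < ℓ (derivWithin γ (Ici 0) a) := by
    simpa [ℓ] using pow_pos (norm_pos_iff.2 hd) 2
  obtain ⟨δ, hδ, hball⟩ := Metric.mem_nhdsWithin_iff.1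
    ((hcont a ha).eventually (eventually_gt_nhds hpos))
  refine ⟨ℓ, δ, hδ, ?_⟩
  rw [← Real.ball_eq_Ioo, inter_comm]
  refine strictMonoOn_of_deriv_pos ((convex_ball a δ).inter (convex_Ici 0))
    ((ℓ.continuous.comp_continuousOn hγ.continuousOn).mono inter_subset_right) fun t ht => ?_
  have htI : t ∈ interior (Ici (0 : ℝ)) := interior_mono inter_subset_right ht
  have ht' := interior_subset ht
  have hdt : HasDerivAt γ (derivWithin γ (Ici 0) t) t :=
    ((hγ.differentiableOn one_ne_zero t ht'.2).hasDerivWithinAt).hasDerivAt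
      (mem_interior_iff_mem_nhds.1 htI)
  have h := (ℓ.hasFDerivAt.comp_hasDerivAt t hdt).deriv
  exact (hball ht').trans_eq h.symm

theorem SmoothlyEngulfed.exists_setDiffeo_univ {K A : Set (EuclideanSpace ℝ (Fin 3))}
    (h : SmoothlyEngulfed K A) :
    ∃ U : Set (EuclideanSpace ℝ (Fin 3)), IsOpen U ∧ K ⊆ U ∧ U ⊆ Aᶜ ∧ SetDiffeo U univ := by
  obtain ⟨φ, hφ, R, hR, hK, hd⟩ := h
  let β := OpenPartialHomeomorph.univBall (0 : EuclideanSpace ℝ (Fin 3)) R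
  have hsrc : β.source = univ := OpenPartialHomeomorph.univBall_source _ _
  have htgt : β.target = Metric.ball 0 R := OpenPartialHomeomorph.univBall_target _ hR
  have hβ (x) : β x ∈ Metric.ball 0 R := htgt ▸ β.map_source (hsrc ▸ mem_univ x)
  have hleft (x) : β.symm (β x) = x := β.left_inv (hsrc ▸ mem_univ x)
  have hright {y} (hy : y ∈ Metric.ball 0 R) : β (β.symm y) = y := β.right_inv (htgt ▸ hy)
  refine ⟨φ ⁻¹' Metric.ball 0 R, Metric.isOpen_ball.preimage hφ.1.continuous, hK,
    fun z hz hzA => hd z hzA (Metric.ball_subset_closedBall hz), β.symm ∘ φ, φ.symm ∘ β,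
    OpenPartialHomeomorph.contDiffOn_univBall_symm.comp hφ.1.contDiffOn fun z hz => hz,
    (hφ.2.comp OpenPartialHomeomorph.contDiff_univBall).contDiffOn, ?_, ?_, fun z hz => ?_,
    fun x _ => ?_⟩
  · refine eq_univ_of_forall fun x => ⟨φ.symm (β x), ?_, ?_⟩
    · simpa using hβ x
    · simp [hleft]
  · ext z
    constructor
    · rintro ⟨x, -, rfl⟩
      simpa using hβ x
    · intro hz
      exact ⟨β.symm (φ z), mem_univ _, by simp [hright hz]⟩
  · simp [hright hz]
  · simp [hleft]

/-- Every compact subset of the complement of a smooth proper multiray `L ⊆ ℝ³` with countably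
many components is contained in an open set `U ⊆ ℝ³ \ L` diffeomorphic to ℝ³ (a smooth open
ball in the complement of `L`). -/
theorem compact_subset_ball_in_compl_multiray
    (ι : Type*) [Countable ι] (ρ : ι → ℝ → EuclideanSpace ℝ (Fin 3))
    (h_inj : ∀ i, Set.InjOn (ρ i) (Set.Ici 0))
    (h_smooth : ∀ i, ContDiffOn ℝ (⊤ : ℕ∞) (ρ i) (Set.Ici 0))
    (h_deriv : ∀ i, ∀ t ∈ Set.Ici (0 : ℝ), derivWithin (ρ i) (Set.Ici 0) t ≠ 0)
    (h_proper : ∀ i, IsProperMap fun t : Set.Ici (0 : ℝ) => ρ i (t : ℝ))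
    (h_disj : Pairwise fun i j => Disjoint (ρ i '' Set.Ici 0) (ρ j '' Set.Ici 0))
    (h_locfin : ∀ K : Set (EuclideanSpace ℝ (Fin 3)), IsCompact K →
      {i : ι | ((ρ i '' Set.Ici 0) ∩ K).Nonempty}.Finite)
    (K : Set (EuclideanSpace ℝ (Fin 3))) (hK : IsCompact K)
    (hKL : K ⊆ (⋃ i, ρ i '' Set.Ici 0)ᶜ) :
    ∃ U : Set (EuclideanSpace ℝ (Fin 3)),
      IsOpen U ∧ K ⊆ U ∧ U ⊆ (⋃ i, ρ i '' Set.Ici 0)ᶜ ∧ SetDiffeo U Set.univ := by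
  classical
  have hcl (i : ι) (c : ℝ) (hc : 0 ≤ c) : IsClosed (ρ i '' Ici c) :=
    isClosed_image_Ici_of_isProperMap (h_proper i) hc
  obtain ⟨R, hR, hKR⟩ := hK.isBounded.subset_ball_lt 0 0
  choose T hT0 hT using fun i => exists_tail_disjoint_of_isProperMap (h_proper i)
    (isCompact_closedBall (0 : EuclideanSpace ℝ (Fin 3)) R)
  set G := (h_locfin _ (isCompact_closedBall (0 : EuclideanSpace ℝ (Fin 3)) R)).toFinset
  have hloc : LocallyFinite fun i => ρ i '' Ici 0 := fun x =>
    ⟨Metric.closedBall x 1, Metric.closedBall_mem_nhds x one_pos,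
      h_locfin _ (isCompact_closedBall x 1)⟩
  have key (F : Finset ι) : SmoothlyEngulfed K
      (⋃ i, ρ i '' Ici (if i ∈ G \ F then T i else 0)) := by
    induction F using Finset.induction_on with
    | empty =>
      refine ⟨1, .one, R, hR, fun z hz => hKR hz, fun z hz hzR => ?_⟩
      obtain ⟨i, hi⟩ := mem_iUnion.1 hz
      by_cases hiG : i ∈ G
      · rw [if_pos (by simpa using hiG)] at hi
        exact disjoint_left.1 (hT i) hi hzR
      · rw [if_neg (by simpa using hiG)] at hi
        exact hiG ((Set.Finite.mem_toFinset _).2 ⟨z, hi, hzR⟩)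
    | insert j F hj ih =>
      let τ : ι → ℝ := fun i => if i ∈ G \ F then T i else 0
      have hτ (i : ι) : 0 ≤ τ i := by
        simp only [τ]
        split_ifs
        exacts [hT0 i, le_rfl]
      have hlocτ : LocallyFinite fun i => ρ i '' Ici (τ i) :=
        hloc.subset fun i => image_mono (Ici_subset_Ici.2 (hτ i))
      have hB : IsClosed (⋃ i : {i // i ≠ j}, ρ i '' Ici (τ i)) :=
        (hlocτ.comp_injective Subtype.val_injective).isClosed_iUnion fun i => hcl i _ (hτ i)
      have hih : SmoothlyEngulfed K
          ((⋃ i : {i // i ≠ j}, ρ i '' Ici (τ i)) ∪ ρ j '' Ici (τ j)) :=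
        ih.mono (union_subset (iUnion_subset fun i => subset_iUnion (fun i => ρ i '' Ici (τ i)) i)
          (subset_iUnion (fun i => ρ i '' Ici (τ i)) j))
      have hext := SmoothlyEngulfed.extend_ray hK.isClosed hB (h_smooth j).continuousOn (h_inj j)
        (hcl j) (disjoint_left.2 fun z hz hzj => hKL hz (mem_iUnion.2 ⟨j, hzj⟩))
        (disjoint_iUnion_left.2 fun i => (h_disj i.2).mono_left
          (image_mono (Ici_subset_Ici.2 (hτ i))))
        (fun a ha => exists_strictMonoOn_of_derivWithin_ne_zero
          ((h_smooth j).of_le (by exact_mod_cast le_top)) ha (h_deriv j a ha)) (hτ j)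
        hih
      refine hext.mono (iUnion_subset fun i => ?_)
      by_cases hij : i = j
      · subst hij
        exact subset_union_of_subset_right (by simp) _
      · refine subset_union_of_subset_left (subset_iUnion_of_subset ⟨i, hij⟩ ?_) _
        simp [τ, hij]
  refine SmoothlyEngulfed.exists_setDiffeo_univ ((key G).mono (iUnion_mono fun i => ?_))
  simp
end
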